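/- Let X be a complex Banach space, p > 0, let (I,‖·‖_I) be an l_p-ideal in B(X) with eigenvalue constant γ_p, let Γ_p > 0 satisfy |det_p(I−F)| ≤ exp(Γ_p ∑_j |λ_j(F)|^p) for all finite rank F on X, and let A ∈ B(X), K ∈ I. Then for every s > ‖A‖, the number n_{A+K}(s) of discrete eigenvalues of A+K in {λ : |λ| > s}, counted with algebraic multiplicity, satisfies n_{A+K}(s) ≤ γ_p^p Γ_p · ((p+1)^{p+1}/p^p) · s/(s−‖A‖)^{p+1} · ‖K‖_I^p. -/

import Mathlib

open scoped ENNReal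

variable {X : Type*} [NormedAddCommGroup X] [NormedSpace ℂ X] [CompleteSpace X]

/-- A continuous linear operator has finite rank. -/
def IsFiniteRank (F : X →L[ℂ] X) : Prop :=
  FiniteDimensional ℂ (LinearMap.range (F : X →ₗ[ℂ] X))

/-- `det(I - F)`, defined as the determinant of the restriction of `I - F` to the
(finite-dimensional) range of `F`. -/
noncomputable def detOneSub (F : X →L[ℂ] X) : ℂ :=
  LinearMap.det
    ((LinearMap.id : LinearMap.range (F : X →ₗ[ℂ] X) →ₗ[ℂ] LinearMap.range (F : X →ₗ[ℂ] X)) -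
      (F : X →ₗ[ℂ] X).restrict fun x _ => LinearMap.mem_range_self _ x)

/-- `tr F`, the trace of the restriction of `F` to its range. -/
noncomputable def trOn (F : X →L[ℂ] X) : ℂ :=
  LinearMap.trace ℂ (LinearMap.range (F : X →ₗ[ℂ] X))
    ((F : X →ₗ[ℂ] X).restrict fun x _ => LinearMap.mem_range_self _ x)

/-- The `p`-regularized determinant `det_p(I-F)` of a finite rank operator. -/
noncomputable def detp (p : ℝ) (F : X →L[ℂ] X) : ℂ :=
  detOneSub F * Complex.exp (∑ k ∈ Finset.Icc 1 (⌈p⌉₊ - 1), trOn (F ^ k) / (k : ℂ))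

open scoped ENNReal

variable {X : Type*} [NormedAddCommGroup X] [NormedSpace ℂ X] [CompleteSpace X]

/-- The Riesz projection of `T` at `μ`, computed with the circle of radius `r` around `μ`. -/
noncomputable def rieszProjection (T : X →L[ℂ] X) (μ : ℂ) (r : ℝ) : X →L[ℂ] X :=
  (2 * Real.pi * Complex.I)⁻¹ • ∮ z in C(μ, r), resolvent T z

/-- `μ` is a discrete eigenvalue of `T`: an isolated point of the spectrum whose
Riesz projection has finite-dimensional range. -/
def IsDiscreteEigenvalue (T : X →L[ℂ] X) (μ : ℂ) : Prop :=
  μ ∈ spectrum ℂ T ∧ ∃ r, 0 < r ∧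
    (∀ z ∈ Metric.closedBall μ r, z ≠ μ → z ∉ spectrum ℂ T) ∧
    FiniteDimensional ℂ (LinearMap.range ((rieszProjection T μ r : X →L[ℂ] X) : X →ₗ[ℂ] X))

open scoped Classical in
/-- The algebraic multiplicity of `μ`: the dimension of the range of the Riesz projection
computed with a radius isolating `μ` from the rest of the spectrum. -/
noncomputable def algebraicMultiplicity (T : X →L[ℂ] X) (μ : ℂ) : ℕ :=
  if h : ∃ r, 0 < r ∧ ∀ z ∈ Metric.closedBall μ r, z ≠ μ → z ∉ spectrum ℂ T then
    Module.finrank ℂ (LinearMap.range ((rieszProjection T μ h.choose : X →L[ℂ] X) : X →ₗ[ℂ] X))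
  else 0

/-- `∑_j |λ_j(T)|^p`, the sum over the discrete eigenvalues of `T`, counted with
algebraic multiplicity (as an extended nonnegative real). -/
noncomputable def eigSum (p : ℝ) (T : X →L[ℂ] X) : ℝ≥0∞ :=
  ∑' μ : {μ : ℂ // IsDiscreteEigenvalue T μ},
    (algebraicMultiplicity T (μ : ℂ) : ℝ≥0∞) * ENNReal.ofReal (‖(μ : ℂ)‖ ^ p)

/-- The number of discrete eigenvalues of `T` in the set `S`, counted with algebraic
multiplicity (as an extended nonnegative real). -/
noncomputable def eigCount (T : X →L[ℂ] X) (S : Set ℂ) : ℝ≥0∞ :=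
  ∑' μ : {μ : ℂ // μ ∈ S ∧ IsDiscreteEigenvalue T μ},
    (algebraicMultiplicity T (μ : ℂ) : ℝ≥0∞)

/-- An `l_p`-ideal in `B(X)`: a quasi-normed subspace (with quasi-norm `norm'` and
quasi-triangle constant `q`) of the bounded operators on `X` in which the finite rank
operators are dense (A1), whose quasi-norm dominates the operator norm (A2), which is a
two-sided ideal with submultiplicative quasi-norm (A3), and whose members have
`l_p`-summable discrete eigenvalue sequences, with eigenvalue constant `γ` (A4). -/
structure LpIdeal (p : ℝ) (X : Type*) [NormedAddCommGroup X] [NormedSpace ℂ X]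
    [CompleteSpace X] where
  carrier : Set (X →L[ℂ] X)
  norm' : (X →L[ℂ] X) → ℝ
  q : ℝ
  γ : ℝ
  one_le_q : 1 ≤ q
  γ_nonneg : 0 ≤ γ
  add_mem : ∀ {K L : X →L[ℂ] X}, K ∈ carrier → L ∈ carrier → K + L ∈ carrier
  smul_mem : ∀ (c : ℂ) {L : X →L[ℂ] X}, L ∈ carrier → c • L ∈ carrier
  norm'_nonneg : ∀ L ∈ carrier, 0 ≤ norm' L
  norm'_eq_zero_iff : ∀ L ∈ carrier, (norm' L = 0 ↔ L = 0)
  norm'_smul : ∀ L ∈ carrier, ∀ c : ℂ, norm' (c • L) = ‖c‖ * norm' L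
  norm'_add_le : ∀ K ∈ carrier, ∀ L ∈ carrier, norm' (K + L) ≤ q * (norm' K + norm' L)
  finiteRank_mem : ∀ F : X →L[ℂ] X, IsFiniteRank F → F ∈ carrier
  dense_finiteRank : ∀ L ∈ carrier, ∀ ε > 0, ∃ F : X →L[ℂ] X, IsFiniteRank F ∧ norm' (L - F) < ε
  opNorm_le : ∀ L ∈ carrier, ‖L‖ ≤ norm' L
  mul_mem : ∀ L ∈ carrier, ∀ A B : X →L[ℂ] X, A * L * B ∈ carrier
  mul_norm'_le : ∀ L ∈ carrier, ∀ A B : X →L[ℂ] X, norm' (A * L * B) ≤ ‖A‖ * norm' L * ‖B‖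
  eig_le : ∀ L ∈ carrier, eigSum p L ≤ ENNReal.ofReal ((γ * norm' L) ^ p)

/-- `D` is continuous on the ideal `I` with respect to the quasi-norm of `I`. -/
def IdealContinuous {p : ℝ} (I : LpIdeal p X) (D : (X →L[ℂ] X) → ℂ) : Prop :=
  ∀ L ∈ I.carrier, ∀ ε > 0, ∃ δ > 0, ∀ K ∈ I.carrier, I.norm' (K - L) < δ → ‖D K - D L‖ < ε

/-- `D` agrees with the `p`-regularized determinant on the finite rank operators. -/
def ExtendsDetp (p : ℝ) (D : (X →L[ℂ] X) → ℂ) : Prop :=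
  ∀ F : X →L[ℂ] X, IsFiniteRank F → D F = detp p F

set_option linter.unusedSectionVars false

/-- The regularized determinant of `1 - B` on a finite-dimensional space, with the first `d`
terms of the logarithm removed. -/
noncomputable def regDet (d : ℕ) {E : Type*} [AddCommGroup E] [Module ℂ E] (B : Module.End ℂ E) :
    ℂ :=
  LinearMap.det (1 - B) *
    Complex.exp (∑ k ∈ Finset.Icc 1 d, LinearMap.trace ℂ E (B ^ k) / (k : ℂ))

section FiniteDimensionalAlgebra

variable {E E' : Type*} [AddCommGroup E] [Module ℂ E] [AddCommGroup E'] [Module ℂ E']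

theorem det_one_sub_comp_comm [FiniteDimensional ℂ E] [FiniteDimensional ℂ E']
    (C : E →ₗ[ℂ] E') (J : E' →ₗ[ℂ] E) :
    LinearMap.det (1 - J ∘ₗ C) = LinearMap.det (1 - C ∘ₗ J) := by
  classical
  let b := Module.finBasis ℂ E
  let b' := Module.finBasis ℂ E'
  rw [← LinearMap.det_toMatrix b, ← LinearMap.det_toMatrix b', map_sub, map_sub,
    LinearMap.toMatrix_one, LinearMap.toMatrix_one, LinearMap.toMatrix_comp b b' b,
    LinearMap.toMatrix_comp b' b b', Matrix.det_one_sub_mul_comm]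

theorem pow_succ_comp_comm (C : E →ₗ[ℂ] E') (J : E' →ₗ[ℂ] E) (k : ℕ) :
    (J ∘ₗ C : Module.End ℂ E) ^ (k + 1) = J ∘ₗ ((C ∘ₗ J : Module.End ℂ E') ^ k) ∘ₗ C := by
  induction k with
  | zero => ext; simp
  | succ k ih =>
    rw [pow_succ', ih, pow_succ' _ k]
    rfl

theorem trace_pow_comp_comm [FiniteDimensional ℂ E] [FiniteDimensional ℂ E']
    (C : E →ₗ[ℂ] E') (J : E' →ₗ[ℂ] E) {k : ℕ} (hk : 1 ≤ k) :
    LinearMap.trace ℂ E ((J ∘ₗ C : Module.End ℂ E) ^ k) =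
      LinearMap.trace ℂ E' ((C ∘ₗ J : Module.End ℂ E') ^ k) := by
  obtain ⟨j, rfl⟩ := Nat.exists_eq_add_of_le' hk
  rw [pow_succ_comp_comm, LinearMap.trace_comp_comm' , pow_succ]
  rfl

end FiniteDimensionalAlgebra

section Transfer

variable {E : Type*} [AddCommGroup E] [Module ℂ E]

theorem detOneSub_eq_det_restrict (F : X →L[ℂ] X) (Y : Submodule ℂ X) [FiniteDimensional ℂ Y]
    (hY : ∀ x, F x ∈ Y) :
    detOneSub F =
      LinearMap.det (1 - (F : X →ₗ[ℂ] X).restrict (p := Y) (q := Y) fun x _ => hY x) := by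
  have hle : LinearMap.range (F : X →ₗ[ℂ] X) ≤ Y := by
    rintro _ ⟨x, rfl⟩; exact hY x
  have : FiniteDimensional ℂ (LinearMap.range (F : X →ₗ[ℂ] X)) :=
    Submodule.finiteDimensional_of_le hle
  have h := det_one_sub_comp_comm
    (((F : X →ₗ[ℂ] X).codRestrict (LinearMap.range (F : X →ₗ[ℂ] X))
      fun x => LinearMap.mem_range_self _ x) ∘ₗ Y.subtype) (Submodule.inclusion hle)
  exact h.symm

theorem trOn_eq_trace_restrict (F : X →L[ℂ] X) (Y : Submodule ℂ X) [FiniteDimensional ℂ Y]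
    (hY : ∀ x, F x ∈ Y) :
    trOn F = LinearMap.trace ℂ Y ((F : X →ₗ[ℂ] X).restrict (p := Y) (q := Y) fun x _ => hY x) := by
  have hle : LinearMap.range (F : X →ₗ[ℂ] X) ≤ Y := by
    rintro _ ⟨x, rfl⟩; exact hY x
  have : FiniteDimensional ℂ (LinearMap.range (F : X →ₗ[ℂ] X)) :=
    Submodule.finiteDimensional_of_le hle
  have h := trace_pow_comp_comm
    (((F : X →ₗ[ℂ] X).codRestrict (LinearMap.range (F : X →ₗ[ℂ] X))
      fun x => LinearMap.mem_range_self _ x) ∘ₗ Y.subtype) (Submodule.inclusion hle) le_rfl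
  rw [pow_one, pow_one] at h
  exact h.symm

theorem trOn_pow_eq_trace_restrict (F : X →L[ℂ] X) (Y : Submodule ℂ X) [FiniteDimensional ℂ Y]
    (hY : ∀ x, F x ∈ Y) {k : ℕ} (hk : 1 ≤ k) :
    trOn (F ^ k) = LinearMap.trace ℂ Y
      (((F : X →ₗ[ℂ] X).restrict (p := Y) (q := Y) fun x _ => hY x) ^ k) := by
  obtain ⟨j, rfl⟩ := Nat.exists_eq_add_of_le' hk
  have hmem : ∀ x, (F ^ (j + 1)) x ∈ Y := fun x => by
    rw [pow_succ']; exact hY _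
  rw [trOn_eq_trace_restrict _ Y hmem, Module.End.pow_restrict]
  congr 1
  ext x
  simp [LinearMap.restrict_apply]

theorem detp_eq_regDet_restrict (p : ℝ) (F : X →L[ℂ] X) (Y : Submodule ℂ X)
    [FiniteDimensional ℂ Y] (hY : ∀ x, F x ∈ Y) :
    detp p F = regDet (⌈p⌉₊ - 1)
      ((F : X →ₗ[ℂ] X).restrict (p := Y) (q := Y) fun x _ => hY x) := by
  unfold detp regDet
  rw [detOneSub_eq_det_restrict F Y hY]
  congr 2
  refine Finset.sum_congr rfl fun k hk => ?_
  rw [trOn_pow_eq_trace_restrict F Y hY (Finset.mem_Icc.mp hk).1]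

variable [FiniteDimensional ℂ E]

/-- Sylvester's identity for `det (1 - JC)`. -/
theorem detOneSub_eq_det_comp (F : X →L[ℂ] X) (C : X →ₗ[ℂ] E) (J : E →ₗ[ℂ] X)
    (h : (F : X →ₗ[ℂ] X) = J ∘ₗ C) : detOneSub F = LinearMap.det (1 - C ∘ₗ J) := by
  have hY : ∀ x, F x ∈ LinearMap.range J := fun x => ⟨C x, (LinearMap.congr_fun h x).symm⟩
  rw [detOneSub_eq_det_restrict F _ hY]
  have := det_one_sub_comp_comm (C ∘ₗ (LinearMap.range J).subtype) J.rangeRestrict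
  have e : (F : X →ₗ[ℂ] X).restrict (p := LinearMap.range J) (q := LinearMap.range J)
      (fun x _ => hY x) = J.rangeRestrict ∘ₗ C ∘ₗ (LinearMap.range J).subtype := by
    ext x
    exact LinearMap.congr_fun h x
  rw [e, this]
  rfl

theorem trOn_eq_trace_comp (F : X →L[ℂ] X) (C : X →ₗ[ℂ] E) (J : E →ₗ[ℂ] X)
    (h : (F : X →ₗ[ℂ] X) = J ∘ₗ C) : trOn F = LinearMap.trace ℂ E (C ∘ₗ J) := by
  have hY : ∀ x, F x ∈ LinearMap.range J := fun x => ⟨C x, (LinearMap.congr_fun h x).symm⟩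
  rw [trOn_eq_trace_restrict F _ hY]
  have := trace_pow_comp_comm (C ∘ₗ (LinearMap.range J).subtype) J.rangeRestrict le_rfl
  rw [pow_one, pow_one] at this
  have e : (F : X →ₗ[ℂ] X).restrict (p := LinearMap.range J) (q := LinearMap.range J)
      (fun x _ => hY x) = J.rangeRestrict ∘ₗ C ∘ₗ (LinearMap.range J).subtype := by
    ext x
    exact LinearMap.congr_fun h x
  rw [e, this]
  rfl

end Transfer

section Roots

open Polynomial

variable {E : Type*} [AddCommGroup E] [Module ℂ E] [FiniteDimensional ℂ E]

theorem charpoly_eq_prod_roots (B : Module.End ℂ E) :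
    B.charpoly = (B.charpoly.roots.map fun a => Polynomial.X - C a).prod :=
  (IsAlgClosed.splits B.charpoly).eq_prod_roots_of_monic B.charpoly_monic

theorem det_aeval_eq_prod_roots (B : Module.End ℂ E) (f : ℂ[X]) :
    LinearMap.det (aeval B f) = (B.charpoly.roots.map fun a => f.eval a).prod := by
  have hlin : ∀ c : ℂ, LinearMap.det (aeval B (C c - Polynomial.X)) =
      (B.charpoly.roots.map fun a => (C c - Polynomial.X : ℂ[X]).eval a).prod := fun c => by
    have h1 : (aeval B (C c - Polynomial.X) : Module.End ℂ E) = algebraMap ℂ _ c - B := by simp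
    rw [h1, ← LinearMap.eval_charpoly]
    conv_lhs => rw [charpoly_eq_prod_roots B]
    rw [eval_multiset_prod, Multiset.map_map]
    simp
  have hconst : ∀ c : ℂ, LinearMap.det (aeval B (C c)) =
      (B.charpoly.roots.map fun a => (C c : ℂ[X]).eval a).prod := fun c => by
    have hcard : B.charpoly.roots.card = Module.finrank ℂ E := by
      rw [← (IsAlgClosed.splits B.charpoly).natDegree_eq_card_roots, LinearMap.charpoly_natDegree]
    have h1 : (aeval B (C c) : Module.End ℂ E) = c • 1 := by
      rw [aeval_C, Algebra.algebraMap_eq_smul_one]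
    rw [h1, LinearMap.det_smul, map_one, mul_one]
    simp [hcard]
  have hmul : ∀ f g : ℂ[X],
      LinearMap.det (aeval B f) = (B.charpoly.roots.map fun a => f.eval a).prod →
      LinearMap.det (aeval B g) = (B.charpoly.roots.map fun a => g.eval a).prod →
      LinearMap.det (aeval B (f * g)) =
        (B.charpoly.roots.map fun a => (f * g).eval a).prod := fun f g hf hg => by
    rw [map_mul, map_mul, hf, hg, ← Multiset.prod_map_mul]
    simp
  rw [(IsAlgClosed.splits f).eq_prod_roots]
  refine hmul _ _ (hconst _) ?_
  induction f.roots using Multiset.induction with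
  | empty => simp
  | cons c s ih =>
    rw [Multiset.map_cons, Multiset.prod_cons]
    refine hmul _ _ ?_ ih
    have : (Polynomial.X - C c : ℂ[X]) = C (-1) * (C c - Polynomial.X) := by simp
    rw [this]
    exact hmul _ _ (hconst _) (hlin _)

theorem det_one_sub_smul_eq_prod_roots (B : Module.End ℂ E) (z : ℂ) :
    LinearMap.det (1 - z • B) = (B.charpoly.roots.map fun a => 1 - z * a).prod := by
  have := det_aeval_eq_prod_roots B (1 - C z * Polynomial.X)
  simpa [Algebra.algebraMap_eq_smul_one] using this

theorem trace_pow_eq_sum_roots (B : Module.End ℂ E) (k : ℕ) :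
    LinearMap.trace ℂ E (B ^ k) = (B.charpoly.roots.map fun a => a ^ k).sum := by
  have h : (B ^ k).charpoly =
      ((B.charpoly.roots.map fun a => a ^ k).map fun a => Polynomial.X - C a).prod := by
    refine Polynomial.funext fun t => ?_
    have := det_aeval_eq_prod_roots B (C t - Polynomial.X ^ k)
    rw [LinearMap.eval_charpoly, eval_multiset_prod, Multiset.map_map, Multiset.map_map]
    simpa using this
  rw [Module.End.trace_eq_sum_roots_charpoly_of_splits (IsAlgClosed.splits _), h,
    roots_multiset_prod_X_sub_C]

theorem hasEigenvalue_of_mem_roots {B : Module.End ℂ E} {a : ℂ} (h : a ∈ B.charpoly.roots) :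
    B.HasEigenvalue a :=
  (Module.End.hasEigenvalue_iff_isRoot_charpoly B a).mpr (isRoot_of_mem_roots h)

theorem card_roots_charpoly (B : Module.End ℂ E) :
    B.charpoly.roots.card = Module.finrank ℂ E := by
  rw [← (IsAlgClosed.splits B.charpoly).natDegree_eq_card_roots, LinearMap.charpoly_natDegree]

end Roots

section Differentiability

variable {E : Type*} [NormedAddCommGroup E]
  [NormedSpace ℂ E] [FiniteDimensional ℂ E]

theorem DifferentiableAt.linearMap_trace {f : ℂ → E →L[ℂ] E} {w : ℂ}
    (hf : DifferentiableAt ℂ f w) :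
    DifferentiableAt ℂ (fun w => LinearMap.trace ℂ E (f w : E →ₗ[ℂ] E)) w := by
  let t : (E →L[ℂ] E) →ₗ[ℂ] ℂ := LinearMap.trace ℂ E ∘ₗ ContinuousLinearMap.coeLM ℂ
  exact (LinearMap.toContinuousLinearMap t).differentiableAt.comp w hf

theorem DifferentiableAt.linearMap_det {f : ℂ → E →L[ℂ] E} {w : ℂ}
    (hf : DifferentiableAt ℂ f w) :
    DifferentiableAt ℂ (fun w => LinearMap.det (f w : E →ₗ[ℂ] E)) w := by
  classical
  let b := Module.finBasis ℂ E
  have h : ∀ w, LinearMap.det (f w : E →ₗ[ℂ] E) =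
      (LinearMap.toMatrix b b (f w : E →ₗ[ℂ] E)).det := fun w => (LinearMap.det_toMatrix b _).symm
  simp_rw [h, Matrix.det_apply, LinearMap.toMatrix_apply]
  refine DifferentiableAt.fun_sum fun σ _ => DifferentiableAt.const_smul ?_ _
  refine DifferentiableAt.fun_finsetProd (𝕜 := ℂ) (𝔸' := ℂ) fun i _ => ?_
  exact (LinearMap.toContinuousLinearMap (b.coord (σ i))).differentiableAt.comp w
    (hf.clm_apply (differentiableAt_const (b i)))

theorem DifferentiableAt.regDet {f : ℂ → E →L[ℂ] E} {w : ℂ} (d : ℕ)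
    (hf : DifferentiableAt ℂ f w) :
    DifferentiableAt ℂ (fun w => regDet d (f w : E →ₗ[ℂ] E)) w := by
  unfold _root_.regDet
  refine DifferentiableAt.mul ?_ (DifferentiableAt.cexp ?_)
  · exact DifferentiableAt.linearMap_det (f := fun w => 1 - f w)
      ((differentiableAt_const _).sub hf)
  · refine DifferentiableAt.fun_sum fun k _ => ?_
    simp_rw [div_eq_mul_inv]
    refine DifferentiableAt.mul_const ?_ _
    have h := DifferentiableAt.linearMap_trace (f := fun w => f w ^ k) (hf.pow k)
    simpa using h

end Differentiability

section FiniteRank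

variable {F G : X →L[ℂ] X}

theorem isFiniteRank_of_forall_mem (Y : Submodule ℂ X) [FiniteDimensional ℂ Y]
    (hY : ∀ x, F x ∈ Y) : IsFiniteRank F :=
  Submodule.finiteDimensional_of_le (S₂ := Y) (by rintro _ ⟨x, rfl⟩; exact hY x)

theorem IsFiniteRank.add (hF : IsFiniteRank F) (hG : IsFiniteRank G) : IsFiniteRank (F + G) := by
  have h1 : FiniteDimensional ℂ (LinearMap.range (F : X →ₗ[ℂ] X)) := hF
  have h2 : FiniteDimensional ℂ (LinearMap.range (G : X →ₗ[ℂ] X)) := hG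
  exact isFiniteRank_of_forall_mem
    (LinearMap.range (F : X →ₗ[ℂ] X) ⊔ LinearMap.range (G : X →ₗ[ℂ] X))
    fun x => Submodule.add_mem_sup ⟨x, rfl⟩ ⟨x, rfl⟩

theorem IsFiniteRank.mul_left (A : X →L[ℂ] X) (hF : IsFiniteRank F) : IsFiniteRank (A * F) := by
  have h1 : FiniteDimensional ℂ (LinearMap.range (F : X →ₗ[ℂ] X)) := hF
  exact isFiniteRank_of_forall_mem ((LinearMap.range (F : X →ₗ[ℂ] X)).map (A : X →ₗ[ℂ] X))
    fun x => ⟨F x, ⟨x, rfl⟩, rfl⟩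

theorem IsFiniteRank.mul_right (A : X →L[ℂ] X) (hF : IsFiniteRank F) : IsFiniteRank (F * A) := by
  have h1 : FiniteDimensional ℂ (LinearMap.range (F : X →ₗ[ℂ] X)) := hF
  exact isFiniteRank_of_forall_mem (LinearMap.range (F : X →ₗ[ℂ] X)) fun x => ⟨A x, rfl⟩

theorem IsFiniteRank.smul (c : ℂ) (hF : IsFiniteRank F) : IsFiniteRank (c • F) := by
  have : c • F = (c • 1 : X →L[ℂ] X) * F := by rw [smul_mul_assoc, one_mul]
  rw [this]
  exact hF.mul_left _

theorem IsFiniteRank.sub (hF : IsFiniteRank F) (hG : IsFiniteRank G) : IsFiniteRank (F - G) := by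
  have : F - G = F + (-1 : ℂ) • G := by rw [neg_one_smul, sub_eq_add_neg]
  rw [this]
  exact hF.add (hG.smul _)

theorem isFiniteRank_zero : IsFiniteRank (0 : X →L[ℂ] X) :=
  isFiniteRank_of_forall_mem (⊥ : Submodule ℂ X) fun _ => Submodule.zero_mem _

/-- The regularized determinant is multiplicative on operators annihilating each other. -/
theorem detp_add_of_mul_eq_zero (p : ℝ) (hF : IsFiniteRank F) (hG : IsFiniteRank G)
    (h1 : F * G = 0) (h2 : G * F = 0) : detp p (F + G) = detp p F * detp p G := by
  have i1 : FiniteDimensional ℂ (LinearMap.range (F : X →ₗ[ℂ] X)) := hF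
  have i2 : FiniteDimensional ℂ (LinearMap.range (G : X →ₗ[ℂ] X)) := hG
  set Y := LinearMap.range (F : X →ₗ[ℂ] X) ⊔ LinearMap.range (G : X →ₗ[ℂ] X) with hYdef
  have hFY : ∀ x, F x ∈ Y := fun x => Submodule.mem_sup_left ⟨x, rfl⟩
  have hGY : ∀ x, G x ∈ Y := fun x => Submodule.mem_sup_right ⟨x, rfl⟩
  have hY : ∀ x, (F + G) x ∈ Y := fun x => Y.add_mem (hFY x) (hGY x)
  rw [detp_eq_regDet_restrict p F Y hFY, detp_eq_regDet_restrict p G Y hGY,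
    detp_eq_regDet_restrict p (F + G) Y hY]
  set f : Module.End ℂ Y := (F : X →ₗ[ℂ] X).restrict (p := Y) (q := Y) fun x _ => hFY x
  set g : Module.End ℂ Y := (G : X →ₗ[ℂ] X).restrict (p := Y) (q := Y) fun x _ => hGY x
  have e : ((F + G : X →L[ℂ] X) : X →ₗ[ℂ] X).restrict (p := Y) (q := Y) (fun x _ => hY x) =
      f + g := by ext x; rfl
  have hfg : f * g = 0 := by
    ext x; exact congrArg (fun T : X →L[ℂ] X => T x) h1
  have hgf : g * f = 0 := by
    ext x; exact congrArg (fun T : X →L[ℂ] X => T x) h2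
  have hpow : ∀ k : ℕ, (f + g) ^ (k + 1) = f ^ (k + 1) + g ^ (k + 1) := by
    intro k
    induction k with
    | zero => simp
    | succ k ih =>
      rw [pow_succ, ih, mul_add, add_mul, add_mul, pow_succ g k, mul_assoc _ g f, hgf,
        pow_succ f k, mul_assoc _ f g, hfg]
      simp [pow_succ]
  rw [e]
  unfold regDet
  have hdet : (1 - (f + g)) = (1 - f) * (1 - g) := by
    rw [sub_mul, mul_sub, mul_sub, hfg]; simp; abel
  have hexp : ∑ k ∈ Finset.Icc 1 (⌈p⌉₊ - 1), LinearMap.trace ℂ Y ((f + g) ^ k) / (k : ℂ) =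
      ∑ k ∈ Finset.Icc 1 (⌈p⌉₊ - 1), LinearMap.trace ℂ Y (f ^ k) / (k : ℂ) +
      ∑ k ∈ Finset.Icc 1 (⌈p⌉₊ - 1), LinearMap.trace ℂ Y (g ^ k) / (k : ℂ) := by
    rw [← Finset.sum_add_distrib]
    refine Finset.sum_congr rfl fun k hk => ?_
    obtain ⟨j, rfl⟩ := Nat.exists_eq_add_of_le' (Finset.mem_Icc.mp hk).1
    rw [hpow, map_add, add_div]
  rw [hexp, Complex.exp_add, hdet, map_mul]
  ring

theorem isUnit_one_sub_of_detOneSub_ne_zero (hF : IsFiniteRank F) (h : detOneSub F ≠ 0) :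
    IsUnit (1 - F) := by
  have i1 : FiniteDimensional ℂ (LinearMap.range (F : X →ₗ[ℂ] X)) := hF
  set R := LinearMap.range (F : X →ₗ[ℂ] X)
  have hb : IsUnit ((LinearMap.id : R →ₗ[ℂ] R) -
      (F : X →ₗ[ℂ] X).restrict fun x _ => LinearMap.mem_range_self _ x) :=
    LinearMap.isUnit_iff_isUnit_det _ |>.mpr (isUnit_iff_ne_zero.mpr h)
  have hb' := (Module.End.isUnit_iff _).mp hb
  rw [ContinuousLinearMap.isUnit_iff_bijective]
  constructor
  · rw [injective_iff_map_eq_zero]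
    intro x hx
    have hx' : x = F x := by
      have : x - F x = 0 := hx
      exact sub_eq_zero.mp this
    have hmem : x ∈ R := by rw [hx']; exact LinearMap.mem_range_self _ x
    have := (injective_iff_map_eq_zero _).mp hb'.1 ⟨x, hmem⟩ (by
      ext; exact hx)
    exact congrArg Subtype.val this
  · intro y
    obtain ⟨u, hu⟩ := hb'.2 ⟨F y, LinearMap.mem_range_self _ y⟩
    have hu' : (u : X) - F u = F y := congrArg Subtype.val hu
    refine ⟨y + u, ?_⟩
    change (y + u) - F (y + u) = y
    rw [map_add, ← hu']
    abel

end FiniteRank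

section Factorization

theorem isUnit_one_sub_smul {A : X →L[ℂ] X} {w : ℂ} (h : ‖w‖ * ‖A‖ < 1) :
    IsUnit (1 - w • A) :=
  isUnit_one_sub_of_norm_lt_one (by rwa [norm_smul])

theorem differentiableAt_inverse_one_sub_smul {A : X →L[ℂ] X} {w : ℂ}
    (h : IsUnit (1 - w • A)) :
    DifferentiableAt ℂ (fun w : ℂ => Ring.inverse (1 - w • A)) w := by
  obtain ⟨u, hu⟩ := h
  have h1 : DifferentiableAt ℂ (Ring.inverse : (X →L[ℂ] X) → (X →L[ℂ] X)) (1 - w • A) := by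
    rw [← hu]; exact differentiableAt_inverse u.isUnit
  have h2 : DifferentiableAt ℂ (fun w : ℂ => 1 - w • A) w := by fun_prop
  exact h1.comp w h2

/-- Eigenvalues of `A + F` on an invariant subspace produce zeros of the perturbation determinant
`det (1 - w (1 - wA)⁻¹ F)`. -/
theorem exists_detp_eq_det_mul (p : ℝ) (A F : X →L[ℂ] X) (hF : IsFiniteRank F) (V : Submodule ℂ X)
    [FiniteDimensional ℂ V] (hV : ∀ v ∈ V, (A + F) v ∈ V) :
    ∃ k : ℂ → ℂ, k 0 = 1 ∧ (∀ w, IsUnit (1 - w • A) → DifferentiableAt ℂ k w) ∧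
      ∀ w, IsUnit (1 - w • A) → detp p (w • (Ring.inverse (1 - w • A) * F)) =
        LinearMap.det (1 - w • ((A + F : X →L[ℂ] X) : X →ₗ[ℂ] X).restrict hV) * k w := by
  have i1 : FiniteDimensional ℂ (LinearMap.range (F : X →ₗ[ℂ] X)) := hF
  obtain ⟨Q, hQ⟩ := Submodule.ClosedComplemented.of_finiteDimensional V
  let R := LinearMap.range (F : X →ₗ[ℂ] X)
  let FR : X →L[ℂ] R := F.codRestrict R fun x => LinearMap.mem_range_self _ x
  let S : ℂ → X →L[ℂ] X := fun w => Ring.inverse (1 - w • A)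
  let C : X →L[ℂ] V × R := Q.prod FR
  let J : V × R →L[ℂ] X := R.subtypeL ∘L ContinuousLinearMap.snd ℂ V R
  let M : ℂ → V × R →L[ℂ] V × R := fun w => 1 - w • (C ∘L S w ∘L J)
  let in2 : V × R →L[ℂ] V × R := ContinuousLinearMap.inr ℂ V R ∘L ContinuousLinearMap.snd ℂ V R
  let N : ℂ → V × R →L[ℂ] V × R := fun w =>
    C ∘L S w ∘L V.subtypeL ∘L ContinuousLinearMap.fst ℂ V R + M w ∘L in2
  let Φ : V × R →L[ℂ] V × R := C ∘L V.subtypeL ∘L ContinuousLinearMap.fst ℂ V R + in2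
  have hS0 : S 0 = 1 := by simp [S]
  have hN0 : N 0 = Φ := by
    simp only [N, M, Φ, hS0]
    ext x <;> simp
  have hΦ : LinearMap.det (Φ : V × R →ₗ[ℂ] V × R) ≠ 0 := by
    let Ψ : V × R →L[ℂ] V × R := ContinuousLinearMap.id ℂ _ -
      ContinuousLinearMap.inr ℂ V R ∘L FR ∘L V.subtypeL ∘L ContinuousLinearMap.fst ℂ V R
    have hmul : (Φ : V × R →ₗ[ℂ] V × R) * (Ψ : V × R →ₗ[ℂ] V × R) = 1 := by
      apply LinearMap.ext
      rintro ⟨v, y⟩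
      simp [Φ, Ψ, C, in2, hQ]
    intro h0
    have := congrArg LinearMap.det hmul
    rw [map_mul, h0, zero_mul, map_one] at this
    exact zero_ne_one this
  have hSdiff : ∀ w, IsUnit (1 - w • A) → DifferentiableAt ℂ S w := fun w hw =>
    differentiableAt_inverse_one_sub_smul hw
  have hkey : ∀ w, IsUnit (1 - w • A) →
      (M w : V × R →ₗ[ℂ] V × R) * (Φ : V × R →ₗ[ℂ] V × R) = (N w : V × R →ₗ[ℂ] V × R) *
        LinearMap.prodMap (1 - w • ((A + F : X →L[ℂ] X) : X →ₗ[ℂ] X).restrict hV) LinearMap.id := by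
    intro w hw
    have hSw : S w * (1 - w • A) = 1 := Ring.inverse_mul_cancel _ hw
    apply LinearMap.ext
    rintro ⟨v, y⟩
    have hJC : ∀ x, J (C x) = F x := fun x => rfl
    have h1 : Φ (v, y) = C v + (0, y) := rfl
    have h2 : M w (C v) = C (S w ((v : X) - w • (A v + F v))) := by
      change C v - w • C (S w (J (C v))) = _
      rw [hJC]
      have : S w ((v : X) - w • (A v + F v)) = v - w • S w (F v) := by
        have e1 : S w ((v : X) - w • A v) = v := congrArg (fun T : X →L[ℂ] X => T v) hSw
        rw [smul_add, ← sub_sub, map_sub, e1, map_smul]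
      rw [this, map_sub, map_smul]
    change M w (Φ (v, y)) = C (S w ((v : X) - w • (A v + F v))) + M w (0, y)
    rw [h1, map_add, h2]
  have hdetp : ∀ w, detOneSub (w • (S w * F)) = LinearMap.det (M w : V × R →ₗ[ℂ] V × R) := by
    intro w
    rw [detOneSub_eq_det_comp (w • (S w * F)) (C : X →ₗ[ℂ] V × R)
      ((w • (S w ∘L J) : V × R →L[ℂ] X) : V × R →ₗ[ℂ] X) (by ext x; rfl)]
    congr 1
    ext x <;> simp [M]
  let B : ℂ → R →L[ℂ] R := fun w => w • (FR ∘L S w ∘L R.subtypeL)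
  have htr : ∀ w (k : ℕ), 1 ≤ k → trOn ((w • (S w * F)) ^ k) =
      LinearMap.trace ℂ R ((B w ^ k : R →L[ℂ] R) : R →ₗ[ℂ] R) := by
    intro w k hk
    obtain ⟨j, rfl⟩ := Nat.exists_eq_add_of_le' hk
    have e := pow_succ_comp_comm (FR : X →ₗ[ℂ] R)
      ((w • (S w ∘L R.subtypeL) : R →L[ℂ] X) : R →ₗ[ℂ] X) j
    have e1 : ((B w : R →L[ℂ] R) : R →ₗ[ℂ] R) = (FR : X →ₗ[ℂ] R) ∘ₗ
      ((w • (S w ∘L R.subtypeL) : R →L[ℂ] X) : R →ₗ[ℂ] X) := by ext x; simp [B]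
    rw [trOn_eq_trace_comp ((w • (S w * F)) ^ (j + 1)) (FR : X →ₗ[ℂ] R)
      (((w • (S w ∘L R.subtypeL) : R →L[ℂ] X) : R →ₗ[ℂ] X) ∘ₗ
        (((FR : X →ₗ[ℂ] R) ∘ₗ
          ((w • (S w ∘L R.subtypeL) : R →L[ℂ] X) : R →ₗ[ℂ] X) : Module.End ℂ R) ^ j)),
      ContinuousLinearMap.toLinearMap_pow, e1, pow_succ']
    · rfl
    · rw [ContinuousLinearMap.toLinearMap_pow, LinearMap.comp_assoc, ← e]
      rfl
  refine ⟨fun w => LinearMap.det (N w : V × R →ₗ[ℂ] V × R) /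
    LinearMap.det (Φ : V × R →ₗ[ℂ] V × R) *
      Complex.exp (∑ k ∈ Finset.Icc 1 (⌈p⌉₊ - 1),
        LinearMap.trace ℂ R ((B w ^ k : R →L[ℂ] R) : R →ₗ[ℂ] R) / (k : ℂ)), ?_, ?_, ?_⟩
  · have hB0 : B 0 = 0 := by
      ext x
      change (((0 : ℂ) • (FR (S 0 x)) : R) : X) = 0
      rw [zero_smul]; rfl
    have : ∑ k ∈ Finset.Icc 1 (⌈p⌉₊ - 1),
        LinearMap.trace ℂ R ((B 0 ^ k : R →L[ℂ] R) : R →ₗ[ℂ] R) / (k : ℂ) = 0 := by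
      refine Finset.sum_eq_zero fun k hk => ?_
      have hk : k ≠ 0 := by have := (Finset.mem_Icc.mp hk).1; omega
      rw [hB0, zero_pow hk]; simp
    simp only [hN0, this, Complex.exp_zero, mul_one]
    exact div_self hΦ
  · intro w hw
    have hSw := hSdiff w hw
    refine DifferentiableAt.mul ?_ (DifferentiableAt.cexp ?_)
    · simp_rw [div_eq_mul_inv]
      refine DifferentiableAt.mul_const (DifferentiableAt.linearMap_det ?_) _
      simp only [N, M]
      fun_prop
    · refine DifferentiableAt.fun_sum fun k _ => ?_
      simp_rw [div_eq_mul_inv]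
      refine DifferentiableAt.mul_const ?_ _
      refine DifferentiableAt.linearMap_trace (f := fun w => B w ^ k) ?_
      simp only [B]
      fun_prop
  · intro w hw
    unfold detp
    have e1 := hdetp w
    have e2 := congrArg LinearMap.det (hkey w hw)
    rw [map_mul, map_mul, LinearMap.det_prodMap, LinearMap.det_id, mul_one] at e2
    change detOneSub (w • (S w * F)) * _ = _
    rw [e1, eq_div_of_mul_eq hΦ e2]
    have e3 : ∑ k ∈ Finset.Icc 1 (⌈p⌉₊ - 1), trOn ((w • (S w * F)) ^ k) / (k : ℂ) =
        ∑ k ∈ Finset.Icc 1 (⌈p⌉₊ - 1),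
          LinearMap.trace ℂ R ((B w ^ k : R →L[ℂ] R) : R →ₗ[ℂ] R) / (k : ℂ) :=
      Finset.sum_congr rfl fun k hk => by rw [htr w k (Finset.mem_Icc.mp hk).1]
    change _ * Complex.exp (∑ k ∈ Finset.Icc 1 (⌈p⌉₊ - 1), trOn ((w • (S w * F)) ^ k) / (k : ℂ)) = _
    rw [e3]
    ring

end Factorization

section ComplexAnalysis

open Metric

theorem differentiableAt_multiset_sum {s : Multiset ℂ} {f : ℂ → ℂ → ℂ} {z : ℂ}
    (h : ∀ u ∈ s, DifferentiableAt ℂ (f u) z) :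
    DifferentiableAt ℂ (fun z => (s.map fun u => f u z).sum) z := by
  induction s using Multiset.induction with
  | empty => simp
  | cons a s ih =>
    simp only [Multiset.map_cons, Multiset.sum_cons]
    exact (h a (Multiset.mem_cons_self a s)).fun_add
      (ih fun u hu => h u (Multiset.mem_cons_of_mem hu))

theorem differentiableAt_multiset_prod {s : Multiset ℂ} {f : ℂ → ℂ → ℂ} {z : ℂ}
    (h : ∀ u ∈ s, DifferentiableAt ℂ (f u) z) :
    DifferentiableAt ℂ (fun z => (s.map fun u => f u z).prod) z := by
  induction s using Multiset.induction with
  | empty => simp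
  | cons a s ih =>
    simp only [Multiset.map_cons, Multiset.prod_cons]
    exact (h a (Multiset.mem_cons_self a s)).fun_mul
      (ih fun u hu => h u (Multiset.mem_cons_of_mem hu))

theorem norm_multiset_prod (s : Multiset ℂ) (f : ℂ → ℂ) :
    ‖(s.map f).prod‖ = (s.map fun u => ‖f u‖).prod := by
  induction s using Multiset.induction with
  | empty => simp
  | cons a s ih => simp [ih]

theorem norm_le_of_sphere {f : ℂ → ℂ} {R B : ℝ} (hR : 0 < R)
    (hf : ∀ z ∈ closedBall (0 : ℂ) R, DifferentiableAt ℂ f z)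
    (hB : ∀ z, ‖z‖ = R → ‖f z‖ ≤ B) : ∀ z, ‖z‖ ≤ R → ‖f z‖ ≤ B := by
  intro z hz
  have hd : DiffContOnCl ℂ f (ball 0 R) := by
    refine DifferentiableOn.diffContOnCl fun z hz => ?_
    rw [closure_ball _ hR.ne'] at hz
    exact (hf z hz).differentiableWithinAt
  refine Complex.norm_le_of_forall_mem_frontier_norm_le isBounded_ball hd (fun w hw => ?_)
    (z := z) ?_
  · rw [frontier_ball _ hR.ne'] at hw
    exact hB w (by simpa using hw)
  · rw [closure_ball _ hR.ne']; simpa using hz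

theorem norm_conj_mul_sub_eq {R : ℝ} (hR : 0 < R) (a z : ℂ) (hz : ‖z‖ = R) :
    ‖(starRingEnd ℂ a) * R - z / R‖ = ‖1 - z * a‖ := by
  have hR' : (R : ℂ) ≠ 0 := by exact_mod_cast hR.ne'
  have hzz : z * (starRingEnd ℂ z) = (R : ℂ) ^ 2 := by
    rw [Complex.mul_conj, Complex.normSq_eq_norm_sq, hz]; push_cast; ring
  have h : z * (starRingEnd ℂ) ((starRingEnd ℂ a) * R - z / R) = - R * (1 - z * a) := by
    simp only [map_sub, map_mul, map_div₀, Complex.conj_conj, Complex.conj_ofReal]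
    rw [mul_sub, ← mul_div_assoc, hzz]
    field_simp
    ring
  have h2 := congrArg norm h
  rw [norm_mul, norm_mul, RCLike.norm_conj, hz, norm_neg, Complex.norm_real,
    Real.norm_of_nonneg hR.le] at h2
  exact mul_left_cancel₀ hR.ne' h2

/-- A Jensen-type bound for the number of zeros. -/
theorem pow_card_le_of_norm_prod_le {k : ℂ → ℂ} {R B t : ℝ} (hR : 0 < R) (ht : 0 ≤ t)
    (s : Multiset ℂ) (hs : ∀ a ∈ s, t ≤ ‖a‖ * R) (hk0 : k 0 = 1)
    (hk : ∀ z ∈ closedBall (0 : ℂ) R, DifferentiableAt ℂ k z)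
    (hB : ∀ z, ‖z‖ = R → ‖(s.map fun a => 1 - z * a).prod * k z‖ ≤ B) :
    t ^ s.card ≤ B := by
  have h := norm_le_of_sphere (f := fun z =>
    (s.map fun a => (starRingEnd ℂ a) * R - z / R).prod * k z) hR
    (fun z hz => (differentiableAt_multiset_prod fun u _ => by fun_prop).mul (hk z hz))
    (fun z hz => by
      have := hB z hz
      rw [norm_mul, norm_multiset_prod] at this ⊢
      simp_rw [norm_conj_mul_sub_eq hR _ z hz]
      exact this) 0 (by simpa using hR.le)
  simp only [hk0, zero_div, sub_zero, mul_one] at h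
  rw [norm_multiset_prod] at h
  refine le_trans ?_ h
  have : ∀ s : Multiset ℂ, (∀ a ∈ s, t ≤ ‖a‖ * R) →
      t ^ s.card ≤ (s.map fun u => ‖(starRingEnd ℂ u) * (R : ℂ)‖).prod := by
    intro s
    induction s using Multiset.induction with
    | empty => simp
    | cons a s ih =>
      intro hs
      rw [Multiset.card_cons, pow_succ', Multiset.map_cons, Multiset.prod_cons]
      have h1 : t ≤ ‖(starRingEnd ℂ a) * (R : ℂ)‖ := by
        rw [norm_mul, RCLike.norm_conj, Complex.norm_real, Real.norm_of_nonneg hR.le]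
        exact hs a (Multiset.mem_cons_self a s)
      exact mul_le_mul h1 (ih fun u hu => hs u (Multiset.mem_cons_of_mem hu)) (by positivity)
        (norm_nonneg _)
  exact this s hs

/-- Taylor remainders of a bounded holomorphic function are bounded. -/
theorem norm_remainder_le {r : ℝ} (hr : 0 < r) (n : ℕ) : ∀ {f g : ℂ → ℂ} {M : ℝ} (c : ℕ → ℂ),
    (∀ z ∈ closedBall (0 : ℂ) r, DifferentiableAt ℂ g z) →
    (∀ z ∈ closedBall (0 : ℂ) r, f z = z ^ n * g z + ∑ k ∈ Finset.range n, c k * z ^ k) →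
    (∀ z ∈ closedBall (0 : ℂ) r, ‖f z‖ ≤ M) →
    ∀ z ∈ closedBall (0 : ℂ) r, ‖g z‖ ≤ M * (2 / r) ^ n := by
  induction n with
  | zero =>
    intro f g M c _ hfg hM z hz
    have := hfg z hz
    simp only [pow_zero, one_mul, Finset.range_zero, Finset.sum_empty, add_zero] at this
    simpa [this] using hM z hz
  | succ n ih =>
    intro f g M c hg hfg hM z hz
    have h0 : (0 : ℂ) ∈ closedBall (0 : ℂ) r := by simpa using hr.le
    let f1 : ℂ → ℂ := fun z => z ^ n * g z + ∑ k ∈ Finset.range n, c (k + 1) * z ^ k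
    have hf1 : ∀ z ∈ closedBall (0 : ℂ) r, f z = z * f1 z + c 0 := by
      intro z hz
      rw [hfg z hz, Finset.sum_range_succ']
      simp only [f1, mul_add, Finset.mul_sum, pow_succ]
      simp only [pow_zero, mul_one]
      rw [← add_assoc]
      congr 2
      · ring
      · exact Finset.sum_congr rfl fun k _ => by ring
    have hc0 : ‖c 0‖ ≤ M := by
      have := hM 0 h0
      rwa [hf1 0 h0, zero_mul, zero_add] at this
    have hb : ∀ z, ‖z‖ ≤ r → ‖f1 z‖ ≤ 2 * M / r := by
      refine norm_le_of_sphere hr (fun z hz => ?_) fun z hz => ?_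
      · have := hg z hz
        fun_prop
      · have hz' : z ∈ closedBall (0 : ℂ) r := by simp [hz]
        have e : z * f1 z = f z - c 0 := by rw [hf1 z hz']; ring
        have e2 := congrArg norm e
        rw [norm_mul, hz] at e2
        rw [le_div_iff₀ hr, mul_comm, e2]
        linarith [norm_sub_le (f z) (c 0), hM z hz']
    have := ih (f := f1) (g := g) (M := 2 * M / r) (fun k => c (k + 1)) hg (fun z _ => rfl)
      (fun z hz => hb z (by simpa using hz)) z hz
    refine this.trans (le_of_eq ?_)
    rw [pow_succ]; ring

/-- The power series of the remainder of the logarithm. -/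
noncomputable def logTail (d : ℕ) (t : ℂ) : ℂ := -∑' j : ℕ, t ^ j / ((j + d + 1 : ℕ) : ℂ)

theorem norm_pow_div_le (d j : ℕ) (t : ℂ) : ‖t ^ j / ((j + d + 1 : ℕ) : ℂ)‖ ≤ ‖t‖ ^ j := by
  rw [norm_div, norm_pow, Complex.norm_natCast]
  refine div_le_self (by positivity) ?_
  exact_mod_cast Nat.le_add_left 1 (j + d)

theorem logTail_eq {d : ℕ} {t : ℂ} (ht : ‖t‖ < 1) :
    Complex.log (1 - t) + ∑ k ∈ Finset.Icc 1 d, t ^ k / (k : ℂ) = t ^ (d + 1) * logTail d t := by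
  have h := Complex.hasSum_taylorSeries_neg_log ht
  have h2 := h.summable.sum_add_tsum_nat_add (d + 1)
  rw [h.tsum_eq, Finset.sum_range_succ'] at h2
  have e1 : ∑ k ∈ Finset.Icc 1 d, t ^ k / (k : ℂ) =
      ∑ k ∈ Finset.range d, t ^ (k + 1) / ((k + 1 : ℕ) : ℂ) := by
    rw [Finset.range_eq_Ico, Finset.sum_Ico_add' (fun k : ℕ => t ^ k / (k : ℂ)) 0 d 1]
    rfl
  have e2 : t ^ (d + 1) * logTail d t =
      -∑' j : ℕ, t ^ (j + (d + 1)) / ((j + (d + 1) : ℕ) : ℂ) := by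
    rw [logTail, mul_neg, ← tsum_mul_left]
    congr 1
    refine tsum_congr fun j => ?_
    rw [pow_add, add_assoc]; ring
  rw [e1, e2]
  have e3 : t ^ 0 / ((0 : ℕ) : ℂ) = 0 := by simp
  rw [e3] at h2
  linear_combination h2

theorem differentiableAt_logTail (d : ℕ) {t : ℂ} (ht : ‖t‖ < 1) :
    DifferentiableAt ℂ (logTail d) t := by
  obtain ⟨r, hr1, hr2⟩ := exists_between ht
  have hr0 : 0 ≤ r := (norm_nonneg t).trans hr1.le
  have h : DifferentiableOn ℂ (fun t : ℂ => ∑' j : ℕ, t ^ j / ((j + d + 1 : ℕ) : ℂ))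
      (ball 0 r) := by
    refine Complex.differentiableOn_tsum_of_summable_norm
      (summable_geometric_of_lt_one hr0 hr2) (fun j => by fun_prop) isOpen_ball fun j w hw => ?_
    refine (norm_pow_div_le d j w).trans (pow_le_pow_left₀ (norm_nonneg _) ?_ j)
    exact (mem_ball_zero_iff.mp hw).le
  exact (h.differentiableAt (isOpen_ball.mem_nhds (mem_ball_zero_iff.mpr hr1))).neg

theorem norm_logTail_le {d : ℕ} {t : ℂ} (ht : ‖t‖ ≤ 1 / 2) : ‖logTail d t‖ ≤ 2 := by
  have h1 : ‖t‖ < 1 := by linarith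
  rw [logTail, norm_neg]
  refine (tsum_of_norm_bounded (hasSum_geometric_of_lt_one (norm_nonneg t) h1)
    (norm_pow_div_le d · t)).trans ?_
  rw [inv_le_comm₀ (by linarith) two_pos]
  linarith

theorem exp_multiset_sum (s : Multiset ℂ) (f : ℂ → ℂ) :
    Complex.exp (s.map f).sum = (s.map fun u => Complex.exp (f u)).prod := by
  rw [Complex.exp_multiset_sum, Multiset.map_map]; rfl

theorem multiset_sum_map_sum (U : Multiset ℂ) (S : Finset ℕ) (a : ℕ → ℂ) :
    (U.map fun u => ∑ k ∈ S, a k * u ^ k).sum = ∑ k ∈ S, a k * (U.map fun u => u ^ k).sum := by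
  induction U using Multiset.induction with
  | empty => simp
  | cons b s ih => simp [ih, mul_add, Finset.sum_add_distrib]

/-- Borel-Carathéodory bound for the regularized product over `U`. -/
theorem norm_sum_logTail_le {d : ℕ} {U : Multiset ℂ} {c : ℕ → ℂ} {ρ M : ℝ} (hρ : 2 ≤ ρ)
    (hM : 0 < M) (hU : ∀ u ∈ U, ‖u‖ * ρ < 1)
    (h : ∀ z, ‖z‖ ≤ ρ → ‖(U.map fun u => 1 - z * u).prod *
      Complex.exp (∑ k ∈ Finset.Icc 1 d, c k * z ^ k)‖ ≤ Real.exp M) :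
    ‖(U.map fun u => u ^ (d + 1) * logTail d u).sum‖ ≤ 2 * M * (4 / ρ) ^ (d + 1) := by
  have hρ0 : 0 < ρ := by linarith
  have hlt : ∀ z : ℂ, ‖z‖ ≤ ρ → ∀ u ∈ U, ‖z * u‖ < 1 := fun z hz u hu => by
    rw [norm_mul, mul_comm]
    exact (mul_le_mul_of_nonneg_left hz (norm_nonneg u)).trans_lt (hU u hu)
  let φ : ℂ → ℂ := fun z => (U.map fun u => Complex.log (1 - z * u)).sum +
    ∑ k ∈ Finset.Icc 1 d, c k * z ^ k
  have hslit : ∀ t : ℂ, ‖t‖ < 1 → 1 - t ∈ Complex.slitPlane := fun t ht =>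
    Complex.mem_slitPlane_of_norm_lt_one (z := -t) (by simpa using ht)
  have hφd : DifferentiableOn ℂ φ (ball 0 ρ) := fun z hz => by
    have hz' : ‖z‖ ≤ ρ := (mem_ball_zero_iff.mp hz).le
    refine DifferentiableAt.differentiableWithinAt ?_
    refine DifferentiableAt.add (differentiableAt_multiset_sum fun u hu => ?_) (by fun_prop)
    exact DifferentiableAt.clog (by fun_prop) (hslit _ (hlt z hz' u hu))
  have hφexp : ∀ z : ℂ, ‖z‖ ≤ ρ → Complex.exp (φ z) = (U.map fun u => 1 - z * u).prod *
      Complex.exp (∑ k ∈ Finset.Icc 1 d, c k * z ^ k) := fun z hz => by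
    simp only [φ]
    rw [Complex.exp_add, exp_multiset_sum]
    congr 2
    refine Multiset.map_congr rfl fun u hu => Complex.exp_log ?_
    exact Complex.slitPlane_ne_zero (hslit _ (hlt z hz u hu))
  have hre : Set.MapsTo φ (ball 0 ρ) {z | z.re ≤ M} := fun z hz => by
    have hz' : ‖z‖ ≤ ρ := (mem_ball_zero_iff.mp hz).le
    have h1 := h z hz'
    rw [← hφexp z hz', Complex.norm_exp, Real.exp_le_exp] at h1
    exact h1
  have hφ0 : φ 0 = 0 := by
    have : ∑ k ∈ Finset.Icc 1 d, c k * (0 : ℂ) ^ k = 0 :=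
      Finset.sum_eq_zero fun k hk => by
        have : k ≠ 0 := by have := (Finset.mem_Icc.mp hk).1; omega
        rw [zero_pow this, mul_zero]
    simp [φ, this]
  have hφb : ∀ z ∈ closedBall (0 : ℂ) (ρ / 2), ‖φ z‖ ≤ 2 * M := fun z hz => by
    have hz' : ‖z‖ ≤ ρ / 2 := mem_closedBall_zero_iff.mp hz
    have hb := Complex.borelCaratheodory_zero hM hφd hre hρ0
      (mem_ball_zero_iff.mpr (by linarith : ‖z‖ < ρ)) hφ0
    refine hb.trans ?_
    rw [div_le_iff₀ (by linarith)]
    exact mul_le_mul_of_nonneg_left (by linarith) (by linarith)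
  have hg : ∀ z ∈ closedBall (0 : ℂ) (ρ / 2), DifferentiableAt ℂ
      (fun z => (U.map fun u => u ^ (d + 1) * logTail d (z * u)).sum) z := fun z hz => by
    have hz' : ‖z‖ ≤ ρ := (mem_closedBall_zero_iff.mp hz).trans (by linarith)
    refine differentiableAt_multiset_sum fun u hu => DifferentiableAt.const_mul ?_ _
    exact DifferentiableAt.comp (g := logTail d) (f := fun z => z * u) z
      (differentiableAt_logTail d (hlt z hz' u hu)) (by fun_prop)
  have key := norm_remainder_le (r := ρ / 2) (by linarith) (d + 1) (f := φ)
    (g := fun z => (U.map fun u => u ^ (d + 1) * logTail d (z * u)).sum) (M := 2 * M)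
    (fun k => if k = 0 then 0 else c k - (U.map fun u => u ^ k).sum / k) hg ?_ hφb 1
    (by simp; linarith)
  · simp only [one_mul] at key
    refine key.trans (le_of_eq ?_)
    congr 2
    field_simp
    norm_num
  · intro z hz
    have hz' : ‖z‖ ≤ ρ := (mem_closedBall_zero_iff.mp hz).trans (by linarith)
    have e0 : ∀ u ∈ U, Complex.log (1 - z * u) =
        z ^ (d + 1) * (u ^ (d + 1) * logTail d (z * u)) -
          ∑ k ∈ Finset.Icc 1 d, z ^ k / (k : ℂ) * u ^ k := fun u hu => by
      have := logTail_eq (d := d) (hlt z hz' u hu)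
      rw [mul_pow] at this
      rw [eq_sub_iff_add_eq, ← mul_assoc, ← this]
      congr 1
      exact Finset.sum_congr rfl fun k _ => by rw [mul_pow]; ring
    have e1 : (U.map fun u => Complex.log (1 - z * u)).sum =
        z ^ (d + 1) * (U.map fun u => u ^ (d + 1) * logTail d (z * u)).sum -
          ∑ k ∈ Finset.Icc 1 d, z ^ k / (k : ℂ) * (U.map fun u => u ^ k).sum := by
      rw [Multiset.map_congr rfl e0, Multiset.sum_map_sub, Multiset.sum_map_mul_left]
      congr 1
      exact multiset_sum_map_sum U _ _
    have e2 : ∑ k ∈ Finset.range (d + 1),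
        (if k = 0 then 0 else c k - (U.map fun u => u ^ k).sum / k) * z ^ k =
        ∑ k ∈ Finset.Icc 1 d, (c k - (U.map fun u => u ^ k).sum / k) * z ^ k := by
      rw [Finset.sum_range_succ']
      have : ∑ k ∈ Finset.Icc 1 d, (c k - (U.map fun u => u ^ k).sum / k) * z ^ k =
          ∑ k ∈ Finset.range d, (c (k + 1) -
            (U.map fun u => u ^ (k + 1)).sum / ((k + 1 : ℕ) : ℂ)) * z ^ (k + 1) := by
        rw [Finset.range_eq_Ico, Finset.sum_Ico_add'
          (fun k : ℕ => (c k - (U.map fun u => u ^ k).sum / (k : ℂ)) * z ^ k) 0 d 1]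
        rfl
      rw [this]
      simp
    simp only [φ]
    rw [e1, e2, sub_add, sub_eq_add_neg, ← Finset.sum_sub_distrib, ← Finset.sum_neg_distrib]
    congr 1
    exact Finset.sum_congr rfl fun k _ => by ring

/-- A bound for the regularized product over the small characteristic values, in terms of the
growth of the full regularized product. -/
theorem norm_prod_small_le {d : ℕ} {U N : Multiset ℂ} {c : ℕ → ℂ} {ρ M₁ M₂ : ℝ} (hρ : 2 ≤ ρ)
    (hM₁ : 0 < M₁) (hU : ∀ u ∈ U, ‖u‖ * ρ < 1) (hN : ∀ μ ∈ N, 1 < ‖μ‖ * ρ)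
    (h₁ : ∀ z, ‖z‖ = ρ → ‖(N.map fun μ => 1 - z * μ).prod * ((U.map fun u => 1 - z * u).prod *
      Complex.exp (∑ k ∈ Finset.Icc 1 d, c k * z ^ k))‖ ≤ Real.exp M₁)
    (h₂ : ∀ z, ‖z‖ = 2 * ρ → ‖(N.map fun μ => 1 - z * μ).prod * ((U.map fun u => 1 - z * u).prod *
      Complex.exp (∑ k ∈ Finset.Icc 1 d, c k * z ^ k))‖ ≤ Real.exp M₂) :
    ‖(U.map fun u => 1 - u).prod *
      Complex.exp (∑ k ∈ Finset.Icc 1 d, (U.map fun u => u ^ k).sum / (k : ℂ))‖ ≤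
      Real.exp (2 * M₁ * (4 / ρ) ^ (d + 1) + M₂ / Real.log 2 * (2 * (1 / ρ) ^ (d + 1))) := by
  have hρ0 : 0 < ρ := by linarith
  have hρ' : (ρ : ℂ) ≠ 0 := by exact_mod_cast hρ0.ne'
  have hdiff : ∀ z, DifferentiableAt ℂ (fun z => (U.map fun u => 1 - z * u).prod *
      Complex.exp (∑ k ∈ Finset.Icc 1 d, c k * z ^ k)) z := fun z =>
    (differentiableAt_multiset_prod fun u _ => by fun_prop).mul (by fun_prop)
  have hcard : (N.card : ℝ) ≤ M₂ / Real.log 2 := by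
    have hk0 : (U.map fun u => 1 - 0 * u).prod *
        Complex.exp (∑ k ∈ Finset.Icc 1 d, c k * 0 ^ k) = 1 := by
      have : ∑ k ∈ Finset.Icc 1 d, c k * (0 : ℂ) ^ k = 0 :=
        Finset.sum_eq_zero fun k hk => by
          have : k ≠ 0 := by have := (Finset.mem_Icc.mp hk).1; omega
          rw [zero_pow this, mul_zero]
      simp [this]
    have := pow_card_le_of_norm_prod_le (R := 2 * ρ) (t := 2) (by linarith) two_pos.le N
      (fun a ha => by have := hN a ha; linarith) hk0 (fun z _ => hdiff z) h₂
    have h3 := Real.log_le_log (by positivity) this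
    rw [Real.log_exp, Real.log_pow] at h3
    rwa [le_div_iff₀ (Real.log_pos one_lt_two)]
  let x : ℂ → ℂ := fun μ => ((starRingEnd ℂ μ) * (ρ : ℂ) ^ 2)⁻¹
  have hx : ∀ μ ∈ N, ‖x μ‖ * ρ < 1 := fun μ hμ => by
    have h1 := hN μ hμ
    simp only [x, norm_inv, norm_mul, norm_pow, RCLike.norm_conj, Complex.norm_real,
      Real.norm_of_nonneg hρ0.le]
    rw [inv_mul_lt_iff₀ (by nlinarith)]
    nlinarith
  have hUN : ∀ u ∈ U + N.map x, ‖u‖ * ρ < 1 := fun u hu => by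
    rcases Multiset.mem_add.mp hu with hu | hu
    · exact hU u hu
    · obtain ⟨μ, hμ, rfl⟩ := Multiset.mem_map.mp hu
      exact hx μ hμ
  have hfac : ∀ z : ℂ, ∀ μ ∈ N, (starRingEnd ℂ μ) * ρ - z / ρ =
      (starRingEnd ℂ μ * ρ) * (1 - z * x μ) := fun z μ hμ => by
    have hμ0 : starRingEnd ℂ μ ≠ 0 := by
      intro h0
      have := hN μ hμ
      rw [← RCLike.norm_conj μ, h0] at this
      simp at this
      linarith
    simp only [x]
    field_simp
  have hone : ∀ s : Multiset ℂ, (∀ a ∈ s, 1 ≤ ‖starRingEnd ℂ a * (ρ : ℂ)‖) →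
      1 ≤ (s.map fun a => ‖starRingEnd ℂ a * (ρ : ℂ)‖).prod := by
    intro s
    induction s using Multiset.induction with
    | empty => simp
    | cons a s ih =>
      intro h
      rw [Multiset.map_cons, Multiset.prod_cons]
      exact one_le_mul_of_one_le_of_one_le (h a (Multiset.mem_cons_self a s))
        (ih fun u hu => h u (Multiset.mem_cons_of_mem hu))
  have hN1 := hone N fun μ hμ => by
    rw [norm_mul, RCLike.norm_conj, Complex.norm_real, Real.norm_of_nonneg hρ0.le]
    exact (hN μ hμ).le
  have hbig : ∀ z, ‖z‖ ≤ ρ → ‖((U + N.map x).map fun u => 1 - z * u).prod *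
      Complex.exp (∑ k ∈ Finset.Icc 1 d, c k * z ^ k)‖ ≤ Real.exp M₁ := by
    intro z hz
    have h := norm_le_of_sphere (f := fun z =>
      (N.map fun a => (starRingEnd ℂ a) * ρ - z / ρ).prod * ((U.map fun u => 1 - z * u).prod *
        Complex.exp (∑ k ∈ Finset.Icc 1 d, c k * z ^ k))) hρ0
      (fun z _ => (differentiableAt_multiset_prod fun u _ => by fun_prop).mul (hdiff z))
      (fun z hz => by
        have := h₁ z hz
        rw [norm_mul, norm_multiset_prod] at this ⊢
        simp_rw [norm_conj_mul_sub_eq hρ0 _ z hz]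
        exact this) z hz
    refine le_trans ?_ h
    rw [Multiset.map_congr rfl (hfac z), Multiset.prod_map_mul, Multiset.map_add,
      Multiset.prod_add, Multiset.map_map]
    have e : (N.map ((fun u => 1 - z * u) ∘ x)).prod = (N.map fun μ => 1 - z * x μ).prod := rfl
    rw [e]
    generalize (N.map fun μ => 1 - z * x μ).prod = a₁
    generalize (U.map fun u => 1 - z * u).prod = a₂
    generalize Complex.exp (∑ k ∈ Finset.Icc 1 d, c k * z ^ k) = a₃
    have e2 : a₂ * a₁ * a₃ = a₁ * (a₂ * a₃) := by ring
    rw [e2, mul_assoc _ a₁, norm_mul (N.map _).prod (a₁ * (a₂ * a₃)), norm_multiset_prod]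
    refine le_mul_of_one_le_left (by positivity) hN1
  have hT := norm_sum_logTail_le hρ hM₁ hUN hbig
  rw [Multiset.map_add, Multiset.sum_add, Multiset.map_map] at hT
  have hT2 : ‖(N.map ((fun u => u ^ (d + 1) * logTail d u) ∘ x)).sum‖ ≤
      N.card * (2 * (1 / ρ) ^ (d + 1)) := by
    have hgen : ∀ s : Multiset ℂ, (∀ μ ∈ s, ‖x μ‖ * ρ < 1) →
        ‖(s.map ((fun u => u ^ (d + 1) * logTail d u) ∘ x)).sum‖ ≤
        s.card * (2 * (1 / ρ) ^ (d + 1)) := by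
      intro s
      induction s using Multiset.induction with
      | empty => simp
      | cons a s ih =>
        intro h
        rw [Multiset.map_cons, Multiset.sum_cons, Multiset.card_cons]
        have ha : ‖x a‖ ≤ 1 / ρ := by
          rw [le_div_iff₀ hρ0]; exact (h a (Multiset.mem_cons_self a s)).le
        have hρ2 : 1 / ρ ≤ 1 / 2 := one_div_le_one_div_of_le two_pos hρ
        have h1 : ‖x a ^ (d + 1) * logTail d (x a)‖ ≤ 2 * (1 / ρ) ^ (d + 1) := by
          rw [norm_mul, norm_pow, mul_comm]
          exact mul_le_mul (norm_logTail_le (ha.trans hρ2))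
            (pow_le_pow_left₀ (norm_nonneg _) ha _) (by positivity) two_pos.le
        have h2 := ih fun u hu => h u (Multiset.mem_cons_of_mem hu)
        refine (norm_add_le _ _).trans ?_
        push_cast
        have := add_le_add h1 h2
        refine this.trans (le_of_eq (by ring))
    exact hgen N hx
  have hU1 : ∀ u ∈ U, ‖u‖ < 1 := fun u hu => by
    have := hU u hu
    nlinarith [norm_nonneg u]
  have hfin : (U.map fun u => 1 - u).prod *
      Complex.exp (∑ k ∈ Finset.Icc 1 d, (U.map fun u => u ^ k).sum / (k : ℂ)) =
      Complex.exp (U.map fun u => u ^ (d + 1) * logTail d u).sum := by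
    have e1 : (U.map fun u => u ^ (d + 1) * logTail d u).sum =
        (U.map fun u => Complex.log (1 - u)).sum +
          ∑ k ∈ Finset.Icc 1 d, (k : ℂ)⁻¹ * (U.map fun u => u ^ k).sum := by
      rw [← multiset_sum_map_sum, ← Multiset.sum_map_add]
      congr 1
      refine Multiset.map_congr rfl fun u hu => ?_
      rw [← logTail_eq (hU1 u hu)]
      congr 1
      exact Finset.sum_congr rfl fun k _ => by rw [div_eq_inv_mul]
    rw [e1, Complex.exp_add, exp_multiset_sum]
    congr 2
    · refine Multiset.map_congr rfl fun u hu => (Complex.exp_log ?_).symm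
      exact Complex.slitPlane_ne_zero
        (Complex.mem_slitPlane_of_norm_lt_one (z := -u) (by simpa using hU1 u hu))
    · exact Finset.sum_congr rfl fun k _ => by rw [div_eq_inv_mul]
  rw [hfin, Complex.norm_exp, Real.exp_le_exp]
  refine (Complex.re_le_norm _).trans ?_
  have h5 := norm_sub_le ((U.map fun u => u ^ (d + 1) * logTail d u).sum +
    (N.map ((fun u => u ^ (d + 1) * logTail d u) ∘ x)).sum)
    (N.map ((fun u => u ^ (d + 1) * logTail d u) ∘ x)).sum
  rw [add_sub_cancel_right] at h5
  refine h5.trans (add_le_add hT (hT2.trans ?_))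
  exact mul_le_mul_of_nonneg_right hcard (by positivity)

end ComplexAnalysis

section RieszIntegrals

open Metric

theorem clm_circleIntegral {E F : Type*} [NormedAddCommGroup E] [NormedSpace ℂ E] [CompleteSpace E]
    [NormedAddCommGroup F] [NormedSpace ℂ F] [CompleteSpace F] (Φ : E →L[ℂ] F) {f : ℂ → E} {c : ℂ}
    {r : ℝ} (hf : CircleIntegrable f c r) :
    Φ (∮ z in C(c, r), f z) = ∮ z in C(c, r), Φ (f z) := by
  unfold circleIntegral
  rw [← ContinuousLinearMap.intervalIntegral_comp_comm _ hf.out]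
  simp

theorem differentiableAt_resolvent {T : X →L[ℂ] X} {z : ℂ} (hz : z ∉ spectrum ℂ T) :
    DifferentiableAt ℂ (resolvent T) z :=
  (spectrum.hasDerivAt_resolvent_const_left (spectrum.notMem_iff.mp hz)).differentiableAt

theorem mul_resolvent {T : X →L[ℂ] X} {z : ℂ} (hz : z ∉ spectrum ℂ T) :
    T * resolvent T z = z • resolvent T z - 1 := by
  have h : (algebraMap ℂ (X →L[ℂ] X) z - T) * resolvent T z = 1 :=
    Ring.mul_inverse_cancel _ (spectrum.notMem_iff.mp hz)
  rw [sub_mul, Algebra.algebraMap_eq_smul_one, smul_mul_assoc, one_mul] at h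
  rw [← h]; abel

/-- The moments `(2πi)⁻¹ ∮ (z - c)^k (z - T)⁻¹ dz` of the resolvent. -/
noncomputable def resolventMoment (T : X →L[ℂ] X) (c : ℂ) (r : ℝ) (k : ℤ) : X →L[ℂ] X :=
  (2 * Real.pi * Complex.I)⁻¹ • ∮ z in C(c, r), (z - c) ^ k • resolvent T z

theorem rieszProjection_eq_resolventMoment (T : X →L[ℂ] X) (c : ℂ) (r : ℝ) :
    rieszProjection T c r = resolventMoment T c r 0 := by
  simp [rieszProjection, resolventMoment]

variable {T : X →L[ℂ] X} {c : ℂ} {r : ℝ}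

theorem differentiableAt_zpow_smul_resolvent {z : ℂ} (hz : z ∉ spectrum ℂ T) (hzc : z ≠ c) (k : ℤ) :
    DifferentiableAt ℂ (fun z => (z - c) ^ k • resolvent T z) z := by
  have h1 : DifferentiableAt ℂ (fun z : ℂ => z - c) z := by fun_prop
  exact (h1.zpow (Or.inl (sub_ne_zero.mpr hzc))).smul (differentiableAt_resolvent hz)

theorem continuousOn_zpow_smul_resolvent (hr : 0 < r) (h : ∀ z ∈ sphere c r, z ∉ spectrum ℂ T)
    (k : ℤ) : ContinuousOn (fun z => (z - c) ^ k • resolvent T z) (sphere c r) := fun z hz =>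
  (differentiableAt_zpow_smul_resolvent (h z hz) (ne_of_mem_sphere hz hr.ne')
    k).continuousAt.continuousWithinAt

theorem circleIntegrable_zpow_smul_resolvent (hr : 0 < r)
    (h : ∀ z ∈ sphere c r, z ∉ spectrum ℂ T) (k : ℤ) :
    CircleIntegrable (fun z => (z - c) ^ k • resolvent T z) c r :=
  (continuousOn_zpow_smul_resolvent hr h k).circleIntegrable hr.le

theorem commute_resolventMoment {S : X →L[ℂ] X} (hST : Commute S T) (hr : 0 < r)
    (h : ∀ z ∈ sphere c r, z ∉ spectrum ℂ T) (k : ℤ) : Commute S (resolventMoment T c r k) := by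
  have hi := circleIntegrable_zpow_smul_resolvent hr h k
  have h1 := clm_circleIntegral (ContinuousLinearMap.mul ℂ (X →L[ℂ] X) S) hi
  have h2 := clm_circleIntegral ((ContinuousLinearMap.mul ℂ (X →L[ℂ] X)).flip S) hi
  simp only [ContinuousLinearMap.mul_apply', ContinuousLinearMap.flip_apply] at h1 h2
  unfold Commute SemiconjBy resolventMoment
  rw [mul_smul_comm, smul_mul_assoc, h1, h2]
  congr 1
  refine circleIntegral.integral_congr hr.le fun z hz => ?_
  have hc : Commute S (algebraMap ℂ (X →L[ℂ] X) z - T) :=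
    Commute.sub_right (Algebra.commutes z S).symm hST
  have hc' : S * resolvent T z = resolvent T z * S := by
    have hu := spectrum.notMem_iff.mp (h z hz)
    unfold resolvent
    calc _ = Ring.inverse (algebraMap ℂ (X →L[ℂ] X) z - T) * (algebraMap ℂ (X →L[ℂ] X) z - T) * S *
          Ring.inverse (algebraMap ℂ (X →L[ℂ] X) z - T) := by
          rw [Ring.inverse_mul_cancel _ hu, one_mul]
      _ = _ := by
          rw [mul_assoc _ _ S, ← hc.eq, mul_assoc, mul_assoc, Ring.mul_inverse_cancel _ hu, mul_one]
  change S * ((z - c) ^ k • resolvent T z) = (z - c) ^ k • resolvent T z * S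
  rw [mul_smul_comm, smul_mul_assoc, hc']

theorem sub_mul_resolventMoment (hr : 0 < r) (h : ∀ z ∈ sphere c r, z ∉ spectrum ℂ T) (k : ℤ) :
    (T - c • 1) * resolventMoment T c r k =
      resolventMoment T c r (k + 1) - if k = -1 then 1 else 0 := by
  have hi := circleIntegrable_zpow_smul_resolvent hr h k
  have h1 := clm_circleIntegral (ContinuousLinearMap.mul ℂ (X →L[ℂ] X) (T - c • 1)) hi
  simp only [ContinuousLinearMap.mul_apply'] at h1
  have hz : CircleIntegrable (fun z : ℂ => (z - c) ^ k • (1 : X →L[ℂ] X)) c r := by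
    refine ContinuousOn.circleIntegrable hr.le fun z hz => ContinuousAt.continuousWithinAt ?_
    have h1 : DifferentiableAt ℂ (fun z : ℂ => z - c) z := by fun_prop
    have h2 : DifferentiableAt ℂ (fun z : ℂ => (z - c) ^ k • (1 : X →L[ℂ] X)) z :=
      (h1.zpow (Or.inl (sub_ne_zero.mpr (ne_of_mem_sphere hz hr.ne')))).smul_const _
    exact h2.continuousAt
  have h2 : ∮ z in C(c, r), (T - c • 1) * ((z - c) ^ k • resolvent T z) =
      (∮ z in C(c, r), (z - c) ^ (k + 1) • resolvent T z) -
        ∮ z in C(c, r), (z - c) ^ k • (1 : X →L[ℂ] X) := by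
    rw [← circleIntegral.integral_sub (circleIntegrable_zpow_smul_resolvent hr h (k + 1)) hz]
    refine circleIntegral.integral_congr hr.le fun z hz => ?_
    have hne : z - c ≠ 0 := sub_ne_zero.mpr (ne_of_mem_sphere hz hr.ne')
    change (T - c • 1) * ((z - c) ^ k • resolvent T z) =
      (z - c) ^ (k + 1) • resolvent T z - (z - c) ^ k • (1 : X →L[ℂ] X)
    rw [mul_smul_comm, sub_mul, mul_resolvent (h z hz), smul_mul_assoc, one_mul, zpow_add_one₀ hne,
      mul_smul, ← smul_sub, sub_smul]
    congr 1
    abel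
  have h3 : (2 * Real.pi * Complex.I)⁻¹ • ∮ z in C(c, r), (z - c) ^ k • (1 : X →L[ℂ] X) =
      if k = -1 then 1 else 0 := by
    rw [circleIntegral.integral_smul_const, smul_smul]
    split_ifs with hk
    · subst hk
      simp only [zpow_neg_one]
      rw [circleIntegral.integral_sub_center_inv c hr.ne', inv_mul_cancel₀ Complex.two_pi_I_ne_zero,
        one_smul]
    · rw [circleIntegral.integral_sub_zpow_of_ne hk, mul_zero, zero_smul]
  unfold resolventMoment
  rw [mul_smul_comm, h1, h2, smul_sub, h3]

theorem pow_mul_resolventMoment_zero (hr : 0 < r) (h : ∀ z ∈ sphere c r, z ∉ spectrum ℂ T)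
    (k : ℕ) : (T - c • 1) ^ k * resolventMoment T c r 0 = resolventMoment T c r k := by
  induction k with
  | zero => simp
  | succ k ih =>
    rw [pow_succ', mul_assoc, ih, sub_mul_resolventMoment hr h, if_neg (by omega), sub_zero]
    simp

theorem pow_mul_resolventMoment_neg (hr : 0 < r) (h : ∀ z ∈ sphere c r, z ∉ spectrum ℂ T)
    (k : ℕ) : (T - c • 1) ^ (k + 1) * resolventMoment T c r (-(k + 1 : ℕ)) =
      resolventMoment T c r 0 - 1 := by
  induction k with
  | zero => simpa using sub_mul_resolventMoment hr h (-1)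
  | succ k ih =>
    rw [pow_succ, mul_assoc, sub_mul_resolventMoment hr h, if_neg (by omega), sub_zero, ← ih]
    congr 2

theorem exists_norm_resolventMoment_le (hr : 0 < r) (h : ∀ z ∈ sphere c r, z ∉ spectrum ℂ T) :
    ∃ M, 0 < M ∧ ∀ k : ℤ, ‖resolventMoment T c r k‖ ≤ M * r ^ k := by
  have hc : ContinuousOn (resolvent T) (sphere c r) := fun z hz =>
    (differentiableAt_resolvent (h z hz)).continuousAt.continuousWithinAt
  obtain ⟨M, hM⟩ := (isCompact_sphere c r).exists_bound_of_continuousOn hc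
  refine ⟨r * max M 1, by positivity, fun k => ?_⟩
  have := circleIntegral.norm_two_pi_i_inv_smul_integral_le_of_norm_le_const (c := c) hr.le
    (f := fun z => (z - c) ^ k • resolvent T z) (C := r ^ k * max M 1) fun z hz => by
      rw [norm_smul, norm_zpow, mem_sphere_iff_norm.mp hz]
      gcongr
      exact (hM z hz).trans (le_max_left _ _)
  exact this.trans (le_of_eq (by ring))

theorem resolventMoment_eq_of_annulus {r' : ℝ} (hr' : 0 < r') (hle : r' ≤ r)
    (h : ∀ z, r' ≤ ‖z - c‖ → ‖z - c‖ ≤ r → z ∉ spectrum ℂ T) (k : ℤ) :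
    resolventMoment T c r k = resolventMoment T c r' k := by
  unfold resolventMoment
  congr 1
  have hd : ∀ z, r' ≤ ‖z - c‖ → ‖z - c‖ ≤ r →
      DifferentiableAt ℂ (fun z => (z - c) ^ k • resolvent T z) z := fun z h1 h2 =>
    differentiableAt_zpow_smul_resolvent (h z h1 h2)
      (fun e => by rw [e, sub_self, norm_zero] at h1; linarith) k
  refine Complex.circleIntegral_eq_of_differentiable_on_annulus_off_countable hr' hle
    Set.countable_empty (fun z hz => ?_) fun z hz => ?_
  · simp only [Set.mem_sdiff, mem_closedBall, mem_ball, dist_eq_norm, not_lt] at hz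
    exact (hd z hz.2 hz.1).continuousAt.continuousWithinAt
  · simp only [Set.sdiff_empty, Set.mem_sdiff, mem_closedBall, mem_ball, dist_eq_norm, not_le] at hz
    exact hd z hz.2.le hz.1.le

end RieszIntegrals

section DiscreteEigenvalues

open Metric

theorem le_of_forall_pow_mul_le {a b C r : ℝ} (hb : 0 < b) (hr : 0 < r)
    (h : ∀ k : ℕ, a ^ k * b ≤ C * r ^ k) : a ≤ r := by
  by_contra! hlt
  obtain ⟨k, hk⟩ := pow_unbounded_of_one_lt (C / b) ((one_lt_div hr).mpr hlt)
  rw [div_pow, div_lt_div_iff₀ hb (by positivity)] at hk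
  exact absurd (h k) (not_le.mpr hk)

variable {T : X →L[ℂ] X} {μ : ℂ} {r r' : ℝ}

theorem sphere_notMem_spectrum (hr : 0 < r)
    (h : ∀ z ∈ closedBall μ r, z ≠ μ → z ∉ spectrum ℂ T) : ∀ z ∈ sphere μ r, z ∉ spectrum ℂ T :=
  fun z hz => h z (sphere_subset_closedBall hz) (ne_of_mem_sphere hz hr.ne')

theorem rieszProjection_eq_of_le (hr' : 0 < r') (hle : r' ≤ r)
    (h : ∀ z ∈ closedBall μ r, z ≠ μ → z ∉ spectrum ℂ T) :
    rieszProjection T μ r = rieszProjection T μ r' := by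
  rw [rieszProjection_eq_resolventMoment, rieszProjection_eq_resolventMoment]
  refine resolventMoment_eq_of_annulus hr' hle (fun z h1 h2 => h z (mem_closedBall_iff_norm.mpr h2)
    fun e => ?_) 0
  rw [e, sub_self, norm_zero] at h1
  linarith

theorem rieszProjection_eq (hr : 0 < r) (hr' : 0 < r')
    (h : ∀ z ∈ closedBall μ r, z ≠ μ → z ∉ spectrum ℂ T)
    (h' : ∀ z ∈ closedBall μ r', z ≠ μ → z ∉ spectrum ℂ T) :
    rieszProjection T μ r = rieszProjection T μ r' := by
  rcases le_total r r' with hle | hle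
  · exact (rieszProjection_eq_of_le hr hle h').symm
  · exact rieszProjection_eq_of_le hr' hle h

theorem algebraicMultiplicity_eq (hr : 0 < r)
    (h : ∀ z ∈ closedBall μ r, z ≠ μ → z ∉ spectrum ℂ T) :
    algebraicMultiplicity T μ = Module.finrank ℂ
      (LinearMap.range ((rieszProjection T μ r : X →L[ℂ] X) : X →ₗ[ℂ] X)) := by
  have hex : ∃ r, 0 < r ∧ ∀ z ∈ closedBall μ r, z ≠ μ → z ∉ spectrum ℂ T := ⟨r, hr, h⟩
  unfold algebraicMultiplicity
  rw [dif_pos hex, rieszProjection_eq hex.choose_spec.1 hr hex.choose_spec.2 h]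

theorem norm_pow_mul_rieszProjection_le (hr' : 0 < r') (hle : r' ≤ r)
    (h : ∀ z, r' ≤ ‖z - μ‖ → ‖z - μ‖ ≤ r → z ∉ spectrum ℂ T) :
    ∃ M, 0 < M ∧ ∀ k : ℕ, ‖(T - μ • 1) ^ k * rieszProjection T μ r‖ ≤ M * r' ^ k := by
  have hs : ∀ z ∈ sphere μ r, z ∉ spectrum ℂ T := fun z hz =>
    h z (by rwa [mem_sphere_iff_norm.mp hz]) (mem_sphere_iff_norm.mp hz).le
  have hs' : ∀ z ∈ sphere μ r', z ∉ spectrum ℂ T := fun z hz =>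
    h z (mem_sphere_iff_norm.mp hz).ge (by rwa [mem_sphere_iff_norm.mp hz])
  obtain ⟨M, hM, hb⟩ := exists_norm_resolventMoment_le hr' hs'
  refine ⟨M, hM, fun k => ?_⟩
  rw [rieszProjection_eq_resolventMoment, pow_mul_resolventMoment_zero (hr'.trans_le hle) hs,
    resolventMoment_eq_of_annulus hr' hle h]
  exact (hb k).trans (le_of_eq (by norm_num))

theorem apply_mem_range_of_commute {P S : X →L[ℂ] X} (hc : Commute S P) {v : X}
    (hv : v ∈ LinearMap.range (P : X →ₗ[ℂ] X)) : S v ∈ LinearMap.range (P : X →ₗ[ℂ] X) := by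
  obtain ⟨x, rfl⟩ := hv
  exact ⟨S x, (congrArg (fun A : X →L[ℂ] X => A x) hc.eq).symm⟩

theorem commute_rieszProjection {S : X →L[ℂ] X} (hST : Commute S T) (hr : 0 < r)
    (h : ∀ z ∈ sphere μ r, z ∉ spectrum ℂ T) : Commute S (rieszProjection T μ r) := by
  rw [rieszProjection_eq_resolventMoment]
  exact commute_resolventMoment hST hr h 0

theorem eq_zero_of_sub_apply_eq_smul (hr : 0 < r)
    (h : ∀ z ∈ closedBall μ r, z ≠ μ → z ∉ spectrum ℂ T) {v : X} (hv0 : v ≠ 0)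
    (hv : v ∈ LinearMap.range ((rieszProjection T μ r : X →L[ℂ] X) : X →ₗ[ℂ] X)) {ν : ℂ}
    (hν : (T - μ • 1) v = ν • v) : ν = 0 := by
  obtain ⟨x, hx⟩ := hv
  have hpow : ∀ k : ℕ, ((T - μ • 1) ^ k) v = ν ^ k • v := by
    intro k
    induction k with
    | zero => simp
    | succ k ih =>
      rw [pow_succ, mul_apply_eq_comp, hν, map_smul, ih, smul_smul, pow_succ']
  have hle : ∀ r', 0 < r' → r' ≤ r → ‖ν‖ ≤ r' := by
    intro r' hr' hle
    obtain ⟨M, hM, hb⟩ := norm_pow_mul_rieszProjection_le (T := T) (μ := μ) hr' hle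
      fun z h1 h2 => h z (mem_closedBall_iff_norm.mpr h2) fun e => by
        rw [e, sub_self, norm_zero] at h1; linarith
    refine le_of_forall_pow_mul_le (C := M * ‖x‖) (norm_pos_iff.mpr hv0) hr' fun k => ?_
    calc ‖ν‖ ^ k * ‖v‖ = ‖((T - μ • 1) ^ k * rieszProjection T μ r) x‖ := by
          have hx' : rieszProjection T μ r x = v := hx
          rw [mul_apply_eq_comp, hx', hpow, norm_smul, norm_pow]
      _ ≤ M * r' ^ k * ‖x‖ := ContinuousLinearMap.le_of_opNorm_le _ (hb k) x
      _ = _ := by ring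
  by_contra h0
  have hpos : 0 < ‖ν‖ := norm_pos_iff.mpr h0
  have := hle (min r (‖ν‖ / 2)) (lt_min hr (by linarith)) (min_le_left _ _)
  have := this.trans (min_le_right _ _)
  linarith

theorem range_rieszProjection_le_maxGenEigenspace (hr : 0 < r)
    (h : ∀ z ∈ closedBall μ r, z ≠ μ → z ∉ spectrum ℂ T)
    [FiniteDimensional ℂ (LinearMap.range ((rieszProjection T μ r : X →L[ℂ] X) : X →ₗ[ℂ] X))] :
    LinearMap.range ((rieszProjection T μ r : X →L[ℂ] X) : X →ₗ[ℂ] X) ≤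
      Module.End.maxGenEigenspace (T : X →ₗ[ℂ] X) μ := by
  set P := rieszProjection T μ r with hP
  set V := LinearMap.range (P : X →ₗ[ℂ] X) with hV
  have hcomm : Commute (T - μ • 1) P :=
    commute_rieszProjection ((Commute.refl T).sub_left ((Commute.one_left T).smul_left μ)) hr
      (sphere_notMem_spectrum hr h)
  have hinv : ∀ v ∈ V, ((T - μ • 1 : X →L[ℂ] X) : X →ₗ[ℂ] X) v ∈ V := fun v hv =>
    apply_mem_range_of_commute hcomm hv
  let f : Module.End ℂ V := ((T - μ • 1 : X →L[ℂ] X) : X →ₗ[ℂ] X).restrict hinv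
  have heig : ∀ ν, f.HasEigenvalue ν → ν = 0 := by
    intro ν hν
    obtain ⟨v, hv⟩ := hν.exists_hasEigenvector
    exact eq_zero_of_sub_apply_eq_smul hr h (v := (v : X)) (fun h0 => hv.2 (Subtype.ext h0)) v.2
      (congrArg Subtype.val hv.apply_eq_smul)
  have htop : f.maxGenEigenspace 0 = ⊤ := by
    rw [eq_top_iff, ← Module.End.iSup_maxGenEigenspace_eq_top f]
    refine iSup_le fun ν => ?_
    by_cases hν : ν = 0
    · rw [hν]
    · have : f.maxGenEigenspace ν = ⊥ := by
        by_contra hne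
        have hu : f.HasUnifEigenvalue ν ⊤ := hne
        exact hν (heig ν (hu.lt zero_lt_one))
      rw [this]
      exact bot_le
  intro v hv
  obtain ⟨k, hk⟩ := (Module.End.mem_maxGenEigenspace f 0 ⟨v, hv⟩).mp (htop ▸ Submodule.mem_top)
  rw [zero_smul, sub_zero] at hk
  refine (Module.End.mem_maxGenEigenspace _ _ _).mpr ⟨k, ?_⟩
  have hval : ∀ (j : ℕ) (w : V), (((f ^ j) w : V) : X) =
      (((T : X →ₗ[ℂ] X) - μ • (1 : Module.End ℂ X)) ^ j : Module.End ℂ X) w := by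
    intro j
    induction j with
    | zero => intro w; rfl
    | succ j ih =>
      intro w
      rw [pow_succ, pow_succ, Module.End.mul_apply, Module.End.mul_apply, ih]
      rfl
  rw [← hval k ⟨v, hv⟩, hk]
  rfl

/-- Finitely many discrete eigenvalues are carried by a finite-dimensional invariant subspace. -/
theorem exists_invariant_le_iSup (T : X →L[ℂ] X) (S : Finset ℂ)
    (hS : ∀ μ ∈ S, IsDiscreteEigenvalue T μ) :
    ∃ V : Submodule ℂ X, FiniteDimensional ℂ V ∧ (∀ v ∈ V, T v ∈ V) ∧
      V ≤ ⨆ μ ∈ S, Module.End.maxGenEigenspace (T : X →ₗ[ℂ] X) μ ∧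
      ∑ μ ∈ S, algebraicMultiplicity T μ ≤ Module.finrank ℂ V := by
  classical
  induction S using Finset.induction_on with
  | empty => exact ⟨⊥, inferInstance, fun v hv => by simp_all, bot_le, by simp⟩
  | insert μ S hμ ih =>
    obtain ⟨V, hfin, hinv, hle, hcard⟩ := ih fun ν hν => hS ν (Finset.mem_insert_of_mem hν)
    obtain ⟨-, r, hr, h, hfin'⟩ := hS μ (Finset.mem_insert_self _ _)
    set W := LinearMap.range ((rieszProjection T μ r : X →L[ℂ] X) : X →ₗ[ℂ] X) with hW
    have hWle : W ≤ Module.End.maxGenEigenspace (T : X →ₗ[ℂ] X) μ :=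
      range_rieszProjection_le_maxGenEigenspace hr h
    have hdisj : Disjoint W V := by
      have := (Module.End.independent_maxGenEigenspace (T : X →ₗ[ℂ] X)).disjoint_biSup
        (x := μ) (y := (S : Set ℂ)) (by simpa using hμ)
      exact this.mono hWle hle
    refine ⟨W ⊔ V, inferInstance, ?_, ?_, ?_⟩
    · intro v hv
      obtain ⟨w, hw, u, hu, rfl⟩ := Submodule.mem_sup.mp hv
      rw [map_add]
      exact Submodule.add_mem_sup (apply_mem_range_of_commute (commute_rieszProjection
        (Commute.refl T) hr (sphere_notMem_spectrum hr h)) hw) (hinv u hu)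
    · rw [Finset.iSup_insert]
      exact sup_le_sup hWle hle
    · rw [Finset.sum_insert hμ, algebraicMultiplicity_eq hr h]
      have := Submodule.finrank_sup_add_finrank_inf_eq W V
      rw [hdisj.eq_bot, finrank_bot, add_zero] at this
      change Module.finrank ℂ W + _ ≤ _
      omega

theorem mem_of_hasEigenvalue_restrict {S : Finset ℂ} {V : Submodule ℂ X}
    (hV : ∀ v ∈ V, (T : X →ₗ[ℂ] X) v ∈ V)
    (hle : V ≤ ⨆ μ ∈ S, Module.End.maxGenEigenspace (T : X →ₗ[ℂ] X) μ) {a : ℂ}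
    (ha : Module.End.HasEigenvalue ((T : X →ₗ[ℂ] X).restrict hV) a) : a ∈ S := by
  by_contra hmem
  obtain ⟨v, hv⟩ := ha.exists_hasEigenvector
  have hdisj := (Module.End.independent_maxGenEigenspace (T : X →ₗ[ℂ] X)).disjoint_biSup
    (x := a) (y := (S : Set ℂ)) (by simpa using hmem)
  refine hv.2 (Subtype.ext ?_)
  refine Submodule.disjoint_def.mp hdisj v ?_ (hle v.2)
  exact Module.End.eigenspace_le_maxGenEigenspace
    (Module.End.mem_eigenspace_iff.mpr (congrArg Subtype.val hv.apply_eq_smul))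

/-- If two resolvents differ by a function holomorphic near `μ`, the Riesz projections at `μ`
agree. -/
theorem rieszProjection_eq_of_resolvent_sub {T' : X →L[ℂ] X} (hr : 0 < r)
    (h' : ∀ z ∈ closedBall μ r, z ≠ μ → z ∉ spectrum ℂ T') (g : ℂ → X →L[ℂ] X)
    (hg : ∀ z ∈ closedBall μ r, DifferentiableAt ℂ g z)
    (heq : ∀ z ∈ closedBall μ r, z ≠ μ → resolvent T z = resolvent T' z + g z) :
    rieszProjection T μ r = rieszProjection T' μ r := by
  unfold rieszProjection
  congr 1
  have hi : CircleIntegrable (resolvent T') μ r :=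
    ContinuousOn.circleIntegrable hr.le fun z hz => (differentiableAt_resolvent
      (sphere_notMem_spectrum hr h' z hz)).continuousAt.continuousWithinAt
  have hig : CircleIntegrable g μ r :=
    ContinuousOn.circleIntegrable hr.le fun z hz =>
      (hg z (sphere_subset_closedBall hz)).continuousAt.continuousWithinAt
  have h0 : ∮ z in C(μ, r), g z = 0 :=
    Complex.circleIntegral_eq_zero_of_differentiable_on_off_countable hr.le Set.countable_empty
      (fun z hz => (hg z hz).continuousAt.continuousWithinAt)
      fun z hz => hg z (ball_subset_closedBall hz.1)
  calc ∮ z in C(μ, r), resolvent T z = ∮ z in C(μ, r), (resolvent T' z + g z) :=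
        circleIntegral.integral_congr hr.le fun z hz =>
          heq z (sphere_subset_closedBall hz) (ne_of_mem_sphere hz hr.ne')
    _ = _ := by rw [circleIntegral.integral_add hi hig, h0, add_zero]

end DiscreteEigenvalues

section CompactSplitting

open Metric

theorem notMem_spectrum_of_norm_pow_lt {b : X →L[ℂ] X} {z : ℂ} {k : ℕ} (h : ‖b ^ k‖ < ‖z‖ ^ k) :
    z ∉ spectrum ℂ b := fun hz => by
  have h1 := spectrum.norm_le_norm_mul_of_mem (spectrum.pow_mem_pow b k hz)
  have h2 : ‖b ^ k‖ * ‖(1 : X →L[ℂ] X)‖ ≤ ‖b ^ k‖ * 1 := by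
    gcongr; exact ContinuousLinearMap.norm_id_le
  rw [norm_pow] at h1
  linarith

theorem IsFiniteRank.isCompactOperator {F : X →L[ℂ] X} (hF : IsFiniteRank F) :
    IsCompactOperator F := by
  have i1 : FiniteDimensional ℂ (LinearMap.range (F : X →ₗ[ℂ] X)) := hF
  let R := LinearMap.range (F : X →ₗ[ℂ] X)
  have i2 : LocallyCompactSpace R := by
    have := FiniteDimensional.proper ℂ R
    infer_instance
  let FR : X →L[ℂ] R := F.codRestrict R fun x => LinearMap.mem_range_self _ x
  exact (isCompactOperator_of_locallyCompactSpace_rng R.subtypeL).comp_clm FR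

theorem isCompactOperator_of_forall_exists {L : X →L[ℂ] X}
    (h : ∀ ε > 0, ∃ G : X →L[ℂ] X, IsFiniteRank G ∧ ‖L - G‖ < ε) : IsCompactOperator L := by
  have hcl : L ∈ closure {G : X →L[ℂ] X | IsCompactOperator G} := by
    rw [Metric.mem_closure_iff]
    intro ε hε
    obtain ⟨G, hG, hlt⟩ := h ε hε
    exact ⟨G, hG.isCompactOperator, by rwa [dist_eq_norm]⟩
  rwa [isClosed_setOfPred_isCompactOperator.closure_eq] at hcl

/-- A compact idempotent has finite rank. -/
theorem isFiniteRank_of_isCompactOperator {P : X →L[ℂ] X} (hP : IsCompactOperator P)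
    (hid : P * P = P) : IsFiniteRank P := by
  let R := LinearMap.range (P : X →ₗ[ℂ] X)
  have hfix : ∀ x ∈ R, P x = x := by
    rintro _ ⟨y, rfl⟩
    exact congrArg (fun A : X →L[ℂ] X => A y) hid
  have hcl : IsClosed (R : Set X) := by
    have : (R : Set X) = {x | P x = x} := by
      ext x
      exact ⟨hfix x, fun hx => ⟨x, hx⟩⟩
    rw [this]
    exact isClosed_eq P.continuous continuous_id
  have h1 := (hP.codRestrict (V := R) (fun x => LinearMap.mem_range_self _ x) hcl).comp_clm
    R.subtypeL
  have h2 : (Set.codRestrict P R fun x => LinearMap.mem_range_self _ x) ∘ R.subtypeL =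
      (id : R → R) := by
    ext x
    exact hfix x x.2
  rw [h2] at h1
  exact FiniteDimensional.of_isCompactOperator_id (𝕜 := ℂ) h1

variable {L : X →L[ℂ] X} {r r' : ℝ}

theorem rieszProjection_zero_apply_eq (hr' : 0 < r') (hlt : r' < r)
    (h : ∀ z ∈ sphere (0 : ℂ) r, z ∉ spectrum ℂ L) {v : X} {C : ℝ}
    (hv : ∀ k : ℕ, ‖(L ^ k) v‖ ≤ C * r' ^ k) : rieszProjection L 0 r v = v := by
  have hr := hr'.trans hlt
  obtain ⟨M, hM, hb⟩ := exists_norm_resolventMoment_le hr h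
  by_contra hne
  have hpos : 0 < ‖rieszProjection L 0 r v - v‖ := norm_pos_iff.mpr (sub_ne_zero.mpr hne)
  refine absurd (le_of_forall_pow_mul_le (a := r) (r := r')
    (C := M * C) hpos hr' fun k => ?_) (not_le.mpr hlt)
  rcases k with - | k
  · have e := pow_mul_resolventMoment_neg hr h 0
    have e0 : rieszProjection L 0 r v - v = resolventMoment L 0 r (-(0 + 1 : ℕ)) ((L ^ 1) v) := by
      have hc : Commute L (resolventMoment L 0 r (-(0 + 1 : ℕ))) :=
        commute_resolventMoment (Commute.refl L) hr h _
      rw [rieszProjection_eq_resolventMoment, ← mul_apply_eq_comp, ← (hc.pow_left 1).eq]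
      rw [zero_smul, sub_zero] at e
      rw [e]; rfl
    rw [pow_zero, pow_zero, one_mul, mul_one, e0]
    refine (ContinuousLinearMap.le_of_opNorm_le _ (hb _) _).trans ?_
    calc M * r ^ (-(0 + 1 : ℕ) : ℤ) * ‖(L ^ 1) v‖ ≤ M * r ^ (-(0 + 1 : ℕ) : ℤ) * (C * r' ^ 1) := by
          gcongr; exact hv 1
      _ = M * C * (r' / r) := by
          rw [zpow_neg]; push_cast; simp; field_simp
      _ ≤ M * C := by
          have hC : 0 ≤ C := by
            have := (norm_nonneg _).trans (hv 0)
            simpa using this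
          have : r' / r ≤ 1 := (div_le_one hr).mpr hlt.le
          exact mul_le_of_le_one_right (by positivity) this
  · have e := pow_mul_resolventMoment_neg hr h k
    have e0 : rieszProjection L 0 r v - v =
        resolventMoment L 0 r (-(k + 1 : ℕ)) ((L ^ (k + 1)) v) := by
      have hc : Commute L (resolventMoment L 0 r (-(k + 1 : ℕ))) :=
        commute_resolventMoment (Commute.refl L) hr h _
      rw [rieszProjection_eq_resolventMoment, ← mul_apply_eq_comp, ← (hc.pow_left (k + 1)).eq]
      rw [zero_smul, sub_zero] at e
      rw [e]; rfl
    rw [e0]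
    calc r ^ (k + 1) * ‖resolventMoment L 0 r (-(k + 1 : ℕ)) ((L ^ (k + 1)) v)‖
        ≤ r ^ (k + 1) * (M * r ^ (-(k + 1 : ℕ) : ℤ) * (C * r' ^ (k + 1))) := by
          gcongr
          refine (ContinuousLinearMap.le_of_opNorm_le _ (hb _) _).trans ?_
          gcongr
          exact hv _
      _ = _ := by
          rw [zpow_neg, zpow_natCast]; field_simp

theorem rieszProjection_zero_idempotent (hr' : 0 < r') (hlt : r' < r)
    (h : ∀ z : ℂ, r' ≤ ‖z‖ → ‖z‖ ≤ r → z ∉ spectrum ℂ L) :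
    rieszProjection L 0 r * rieszProjection L 0 r = rieszProjection L 0 r := by
  have hs : ∀ z ∈ sphere (0 : ℂ) r, z ∉ spectrum ℂ L := fun z hz => by
    rw [mem_sphere_zero_iff_norm] at hz
    exact h z (hz ▸ hlt.le) hz.le
  obtain ⟨M, hM, hb⟩ := norm_pow_mul_rieszProjection_le (T := L) (μ := 0) hr' hlt.le
    (by simpa using h)
  ext x
  refine rieszProjection_zero_apply_eq hr' hlt hs (C := M * ‖x‖) fun k => ?_
  have := ContinuousLinearMap.le_of_opNorm_le _ (hb k) x
  rw [zero_smul, sub_zero, mul_apply_eq_comp] at this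
  exact this.trans (le_of_eq (by ring))

theorem exists_annulus_of_sphere (hr : 0 < r) (h : ∀ z ∈ sphere (0 : ℂ) r, z ∉ spectrum ℂ L) :
    ∃ r', 0 < r' ∧ r' < r ∧ ∀ z : ℂ, r' ≤ ‖z‖ → ‖z‖ ≤ r → z ∉ spectrum ℂ L := by
  have hc : IsCompact (spectrum ℂ L ∩ closedBall 0 r) :=
    (spectrum.isCompact L).inter_right isClosed_closedBall
  rcases (spectrum ℂ L ∩ closedBall 0 r).eq_empty_or_nonempty with he | hne
  · refine ⟨r / 2, by linarith, by linarith, fun z _ h2 hz => ?_⟩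
    have : z ∈ spectrum ℂ L ∩ closedBall 0 r := ⟨hz, mem_closedBall_zero_iff.mpr h2⟩
    rw [he] at this
    exact this
  · obtain ⟨w, hw, hmax⟩ := hc.exists_isMaxOn hne continuous_norm.continuousOn
    have hwr : ‖w‖ < r := lt_of_le_of_ne (mem_closedBall_zero_iff.mp hw.2) fun e =>
      h w (mem_sphere_zero_iff_norm.mpr e) hw.1
    refine ⟨(‖w‖ + r) / 2, by positivity, by linarith, fun z h1 h2 hz => ?_⟩
    have : ‖z‖ ≤ ‖w‖ := hmax ⟨hz, mem_closedBall_zero_iff.mpr h2⟩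
    linarith

/-- Operators that are limits of finite rank operators have spectrum-free circles of
arbitrarily small radius. -/
theorem exists_sphere_notMem_spectrum
    (happ : ∀ ε > 0, ∃ G : X →L[ℂ] X, IsFiniteRank G ∧ ‖L - G‖ < ε) {δ : ℝ} (hδ : 0 < δ) :
    ∃ r, 0 < r ∧ r < δ ∧ ∀ z ∈ sphere (0 : ℂ) r, z ∉ spectrum ℂ L := by
  obtain ⟨G, hG, hLG⟩ := happ (δ / 4) (by linarith)
  set H := L - G with hH
  obtain ⟨k, hk0, hkd, hkdet⟩ := exists_detp_eq_det_mul 1 H G hG (⊥ : Submodule ℂ X)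
    (fun v hv => by simp_all)
  have hdet : ∀ w, IsUnit (1 - w • H) → detOneSub (w • (Ring.inverse (1 - w • H) * G)) = k w := by
    intro w hw
    have := hkdet w hw
    rw [LinearMap.det_eq_one_of_subsingleton, one_mul] at this
    rw [← this]
    simp [detp]
  have hunit : ∀ w : ℂ, ‖w‖ < 4 / δ → IsUnit (1 - w • H) := fun w hw => by
    apply isUnit_one_sub_smul
    calc ‖w‖ * ‖H‖ ≤ 4 / δ * ‖H‖ := by gcongr
      _ < 4 / δ * (δ / 4) := by gcongr
      _ = 1 := by field_simp
  have hlt : ∀ w ∈ closedBall (0 : ℂ) (2 / δ), ‖w‖ < 4 / δ := fun w hw => by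
    rw [mem_closedBall_zero_iff] at hw
    exact hw.trans_lt (by gcongr; norm_num)
  have han : AnalyticOnNhd ℂ k (closedBall 0 (2 / δ)) := by
    have h1 : DifferentiableOn ℂ k (ball 0 (4 / δ)) := fun w hw =>
      (hkd w (hunit w (mem_ball_zero_iff.mp hw))).differentiableWithinAt
    exact (h1.analyticOnNhd isOpen_ball).mono fun w hw => mem_ball_zero_iff.mpr (hlt w hw)
  have hfin : {w ∈ closedBall (0 : ℂ) (2 / δ) | k w = 0}.Finite := by
    rcases han.eqOn_zero_or_eventually_ne_zero_of_preconnected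
      (convex_closedBall _ _).isPreconnected with h0 | hne
    · have := h0 (mem_closedBall_self (by positivity))
      rw [hk0] at this
      exact absurd this one_ne_zero
    · refine ((isCompact_closedBall _ _).finite_sdiff_of_mem_codiscreteWithin hne).subset ?_
      rintro w ⟨hw, hw0⟩
      exact ⟨hw, fun hn => hn hw0⟩
  have hfin' := hfin.image fun w : ℂ => ‖w‖⁻¹
  obtain ⟨r, hr, hrn⟩ := (Set.Ioo_infinite (show δ / 2 < δ by linarith)).exists_notMem_finite hfin'
  have hr0 : 0 < r := by have := hr.1; linarith
  refine ⟨r, hr0, hr.2, fun z hz => ?_⟩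
  rw [mem_sphere_zero_iff_norm] at hz
  have hz0 : z ≠ 0 := norm_pos_iff.mp (by rw [hz]; exact hr0)
  have hw : z⁻¹ ∈ closedBall (0 : ℂ) (2 / δ) := by
    rw [mem_closedBall_zero_iff, norm_inv, hz, inv_eq_one_div, div_le_div_iff₀ hr0 hδ]
    have := hr.1
    linarith
  have hu := hunit _ (hlt _ hw)
  have hkne : k z⁻¹ ≠ 0 := fun h0 => hrn ⟨z⁻¹, ⟨hw, h0⟩, by simp [hz]⟩
  have hu2 : IsUnit (1 - z⁻¹ • (Ring.inverse (1 - z⁻¹ • H) * G)) :=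
    isUnit_one_sub_of_detOneSub_ne_zero ((hG.mul_left _).smul _) (by rwa [hdet _ hu])
  rw [spectrum.notMem_iff]
  have e : algebraMap ℂ (X →L[ℂ] X) z - L =
      algebraMap ℂ (X →L[ℂ] X) z *
        ((1 - z⁻¹ • H) * (1 - z⁻¹ • (Ring.inverse (1 - z⁻¹ • H) * G))) := by
    rw [mul_sub (1 - z⁻¹ • H), mul_one, mul_smul_comm, ← mul_assoc, Ring.mul_inverse_cancel _ hu,
      one_mul, sub_sub, ← smul_add, hH, sub_add_cancel, Algebra.algebraMap_eq_smul_one,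
      smul_mul_assoc, one_mul, smul_sub, smul_smul, mul_inv_cancel₀ hz0, one_smul]
  rw [e]
  exact ((IsUnit.mk0 z hz0).map (algebraMap ℂ (X →L[ℂ] X))).mul (hu.mul hu2)

theorem smul_resolvent_eq_of_mul_eq_zero {a b : X →L[ℂ] X} (hab : a * b = 0) (hba : b * a = 0)
    {z : ℂ} (hz : z ≠ 0) (hb : z ∉ spectrum ℂ b) :
    (z ∉ spectrum ℂ (a + b) ↔ z ∉ spectrum ℂ a) ∧ (z ∉ spectrum ℂ a →
      resolvent (a + b) z = resolvent a z + (resolvent b z - algebraMap ℂ (X →L[ℂ] X) z⁻¹)) := by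
  set ζ := algebraMap ℂ (X →L[ℂ] X) z with hζ
  have hζu : IsUnit ζ := (IsUnit.mk0 z hz).map (algebraMap ℂ (X →L[ℂ] X))
  have hca : ζ * a = a * ζ := Algebra.commutes z a
  have hcb : ζ * b = b * ζ := Algebra.commutes z b
  have e1 : ζ * (ζ - (a + b)) = (ζ - a) * (ζ - b) := by
    simp only [mul_sub, sub_mul, mul_add, hab, hca]; abel
  have e2 : (ζ - a) * (ζ - b) = (ζ - b) * (ζ - a) := by
    simp only [mul_sub, sub_mul, hab, hba, hca, hcb]; abel
  rw [spectrum.notMem_iff] at hb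
  have hiff : IsUnit (ζ - (a + b)) ↔ IsUnit (ζ - a) := by
    constructor
    · intro h
      have h1 : IsUnit ((ζ - a) * (ζ - b)) := e1 ▸ hζu.mul h
      exact ((Commute.isUnit_mul_iff e2).mp h1).1
    · intro h
      have h1 : IsUnit (ζ * (ζ - (a + b))) := e1 ▸ h.mul hb
      have hc : Commute ζ (ζ - (a + b)) :=
        (Commute.refl ζ).sub_right (Commute.add_right hca hcb)
      exact (hc.isUnit_mul_iff.mp h1).2
  refine ⟨by rw [spectrum.notMem_iff, spectrum.notMem_iff]; exact hiff, fun ha => ?_⟩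
  rw [spectrum.notMem_iff] at ha
  have hab' : IsUnit (ζ - (a + b)) := hiff.mpr ha
  have hζi : ζ * algebraMap ℂ (X →L[ℂ] X) z⁻¹ = 1 := by
    rw [hζ, ← map_mul, mul_inv_cancel₀ hz, map_one]
  set ι := algebraMap ℂ (X →L[ℂ] X) z⁻¹ with hι
  change Ring.inverse (ζ - (a + b)) = Ring.inverse (ζ - a) + (Ring.inverse (ζ - b) - ι)
  have ra : (ζ - a) * Ring.inverse (ζ - a) = 1 := Ring.mul_inverse_cancel _ ha
  have rb : (ζ - b) * Ring.inverse (ζ - b) = 1 := Ring.mul_inverse_cancel _ hb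
  refine hab'.mul_left_cancel ?_
  rw [Ring.mul_inverse_cancel _ hab']
  refine hζu.mul_left_cancel ?_
  rw [← mul_assoc, e1, mul_add, mul_sub _ _ ι, mul_assoc (ζ - a) (ζ - b) (Ring.inverse (ζ - b)), rb,
    e2, mul_assoc, ra, mul_one, mul_one, ← e2]
  have e3 : (ζ - a) * (ζ - b) * ι = ζ - a - b := by
    rw [← e1, mul_assoc, (Algebra.commutes z⁻¹ _).symm, ← mul_assoc, hζi, one_mul, sub_sub]
  rw [e3, mul_one]
  abel

theorem IsFiniteRank.exists_eigenvector {F : X →L[ℂ] X} (hF : IsFiniteRank F) {μ : ℂ} (hμ0 : μ ≠ 0)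
    (hμ : μ ∈ spectrum ℂ F) : ∃ v : X, v ≠ 0 ∧ F v = μ • v := by
  rcases IsCompactOperator.hasEigenvalue_or_mem_resolventSet hF.isCompactOperator hμ0 with h | h
  · obtain ⟨v, hv⟩ := h.exists_hasEigenvector
    exact ⟨v, hv.2, hv.apply_eq_smul⟩
  · exact absurd h hμ

/-- Spectral splitting of a limit of finite rank operators into a finite rank part, carrying large
eigenvalues, and a part with small spectral radius. -/
theorem exists_splitting (p : ℝ) (hp : 0 < p)
    (happ : ∀ ε > 0, ∃ G : X →L[ℂ] X, IsFiniteRank G ∧ ‖L - G‖ < ε) {δ : ℝ} (hδ : 0 < δ) :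
    ∃ r, 0 < r ∧ r < δ ∧ ∃ P : X →L[ℂ] X, IsFiniteRank P ∧ P * P = P ∧ Commute L P ∧
      (∃ k : ℕ, ‖((1 - P) * L) ^ k‖ < r ^ k) ∧
      (∀ (μ : ℂ) (v : X), v ≠ 0 → P v = v → L v = μ • v → r < ‖μ‖) ∧
      eigSum p (P * L) ≤ eigSum p L := by
  obtain ⟨r, hr, hrδ, hs⟩ := exists_sphere_notMem_spectrum happ hδ
  obtain ⟨r', hr', hlt, hann⟩ := exists_annulus_of_sphere hr hs
  set Q := rieszProjection L 0 r with hQ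
  have hQQ : Q * Q = Q := rieszProjection_zero_idempotent hr' hlt hann
  have hLQ : Commute L Q := commute_rieszProjection (Commute.refl L) hr hs
  set P := 1 - Q with hP
  have hPP : P * P = P := by rw [hP, sub_mul, one_mul, mul_sub, mul_one, hQQ, sub_self, sub_zero]
  have hLP : Commute L P := (Commute.one_right L).sub_right hLQ
  have hPQ : P * Q = 0 := by rw [hP, sub_mul, one_mul, hQQ, sub_self]
  have hQP : Q * P = 0 := by rw [hP, mul_sub, mul_one, hQQ, sub_self]
  have hQ1 : 1 - P = Q := by rw [hP, sub_sub_cancel]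
  have hPfin : IsFiniteRank P := by
    refine isFiniteRank_of_isCompactOperator ?_ hPP
    have h1 := sub_mul_resolventMoment hr hs (-1)
    rw [if_pos rfl, zero_smul, sub_zero, neg_add_cancel,
      ← rieszProjection_eq_resolventMoment] at h1
    have h2 : P = -(L * resolventMoment L 0 r (-1)) := by rw [h1, hP, neg_sub]
    have h3 : IsCompactOperator (L * resolventMoment L 0 r (-1) : X →L[ℂ] X) :=
      (isCompactOperator_of_forall_exists happ).comp_clm (resolventMoment L 0 r (-1))
    rw [h2]
    exact h3.neg
  obtain ⟨M, hM, hb⟩ := norm_pow_mul_rieszProjection_le (T := L) (μ := 0) hr' hlt.le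
    (by simpa using hann)
  have hsmall : ∃ k : ℕ, ‖(Q * L) ^ k‖ < r ^ k := by
    obtain ⟨k, hk⟩ := pow_unbounded_of_one_lt M ((one_lt_div hr').mpr hlt)
    rw [div_pow, lt_div_iff₀ (by positivity)] at hk
    have hQpow : ∀ k : ℕ, Q ^ (k + 1) = Q := fun k => by
      induction k with
      | zero => simp
      | succ k ih => rw [pow_succ, ih, hQQ]
    have hr'k : ∀ k : ℕ, ‖L ^ (k + 1) * Q‖ ≤ M * r' ^ (k + 1) := fun k => by simpa using hb (k + 1)
    rcases k with - | k
    · refine ⟨1, ?_⟩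
      rw [pow_one, pow_one, ← hLQ.eq]
      have h1 := hr'k 0
      simp only [zero_add, pow_one, pow_zero, mul_one] at h1 hk
      nlinarith
    · refine ⟨k + 1, ?_⟩
      rw [hLQ.symm.mul_pow, hQpow, ← (hLQ.pow_left (k + 1)).eq]
      exact (hr'k k).trans_lt hk
  have hlarge : ∀ (μ : ℂ) (v : X), v ≠ 0 → P v = v → L v = μ • v → r < ‖μ‖ := by
    intro μ v hv0 hPv hLv
    have hpow : ∀ k : ℕ, (L ^ k) v = μ ^ k • v := by
      intro k
      induction k with
      | zero => simp
      | succ k ih =>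
        rw [pow_succ, mul_apply_eq_comp, hLv, map_smul, ih, smul_smul, pow_succ']
    by_contra! hle
    have hμ : μ ∈ spectrum ℂ L := fun hu => by
      obtain ⟨u, hu⟩ := hu
      have h1 : (u : X →L[ℂ] X) v = 0 := by
        rw [hu, Algebra.algebraMap_eq_smul_one]
        change μ • v - L v = 0
        rw [hLv, sub_self]
      have h2 : v = ((u⁻¹ : (X →L[ℂ] X)ˣ) : X →L[ℂ] X) ((u : X →L[ℂ] X) v) := by
        rw [← mul_apply_eq_comp, Units.inv_mul]; rfl
      rw [h1, map_zero] at h2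
      exact hv0 h2
    have hle' : ‖μ‖ ≤ r' := by
      by_contra! h1
      exact hann μ h1.le hle hμ
    have hQv : Q v = v := rieszProjection_zero_apply_eq hr' hlt hs (C := ‖v‖) fun k => by
      rw [hpow, norm_smul, norm_pow, mul_comm]
      gcongr
    have : P v = v - Q v := rfl
    rw [hPv, hQv, sub_self] at this
    exact hv0 this
  refine ⟨r, hr, hrδ, P, hPfin, hPP, hLP, by rwa [hQ1], hlarge, ?_⟩
  set a := P * L with ha
  set b := Q * L with hb'
  have hab0 : a * b = 0 := by
    rw [ha, hb', ← hLP.eq, mul_assoc, ← mul_assoc P, hPQ, zero_mul, mul_zero]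
  have hba0 : b * a = 0 := by
    rw [ha, hb', ← hLQ.eq, mul_assoc, ← mul_assoc Q, hQP, zero_mul, mul_zero]
  have hsum : a + b = L := by rw [ha, hb', ← add_mul, hP, sub_add_cancel, one_mul]
  have hbspec : ∀ z : ℂ, r ≤ ‖z‖ → z ∉ spectrum ℂ b := fun z hz => by
    obtain ⟨k, hk⟩ := hsmall
    exact notMem_spectrum_of_norm_pow_lt (k := k) (hk.trans_le (by gcongr))
  have hafin : IsFiniteRank a := hPfin.mul_right L
  have hdisc : ∀ μ, μ ≠ 0 → IsDiscreteEigenvalue a μ →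
      IsDiscreteEigenvalue L μ ∧ algebraicMultiplicity a μ = algebraicMultiplicity L μ := by
    rintro μ hμ0 ⟨hμ, R, hR, hiso, hfin⟩
    obtain ⟨v, hv0, hv⟩ := hafin.exists_eigenvector hμ0 hμ
    have hPa : P * a = a := by rw [ha, ← mul_assoc, hPP]
    have hPv : P v = v := by
      have h1 : P (a v) = a v := congrArg (fun A : X →L[ℂ] X => A v) hPa
      rw [hv, map_smul] at h1
      exact smul_right_injective X hμ0 h1
    have hLv : L v = μ • v := by
      rw [← hv, ha, ← hLP.eq, mul_apply_eq_comp, hPv]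
    have hμr := hlarge μ v hv0 hPv hLv
    set t := min R ((‖μ‖ - r) / 2) with ht
    have ht0 : 0 < t := lt_min hR (by linarith)
    have hball : ∀ z ∈ closedBall μ t, r ≤ ‖z‖ := fun z hz => by
      have h1 : ‖z - μ‖ ≤ (‖μ‖ - r) / 2 := (mem_closedBall_iff_norm.mp hz).trans (min_le_right _ _)
      have h2 := norm_sub_norm_le μ z
      rw [norm_sub_rev] at h2
      linarith
    have hisoa : ∀ z ∈ closedBall μ t, z ≠ μ → z ∉ spectrum ℂ a := fun z hz =>
      hiso z (closedBall_subset_closedBall (min_le_left _ _) hz)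
    have hkey : ∀ z ∈ closedBall μ t, z ≠ 0 ∧ z ∉ spectrum ℂ b := fun z hz =>
      ⟨norm_pos_iff.mp (hr.trans_le (hball z hz)), hbspec z (hball z hz)⟩
    have hisoL : ∀ z ∈ closedBall μ t, z ≠ μ → z ∉ spectrum ℂ L := fun z hz hne => by
      have := (smul_resolvent_eq_of_mul_eq_zero hab0 hba0 (hkey z hz).1 (hkey z hz).2).1
      rw [hsum] at this
      exact this.mpr (hisoa z hz hne)
    have hμL : μ ∈ spectrum ℂ L := by
      have hmem := mem_closedBall_self (x := μ) ht0.le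
      have := (smul_resolvent_eq_of_mul_eq_zero hab0 hba0 (hkey μ hmem).1 (hkey μ hmem).2).1
      rw [hsum] at this
      by_contra hn
      exact this.mp hn hμ
    have hproj : rieszProjection L μ t = rieszProjection a μ t := by
      refine rieszProjection_eq_of_resolvent_sub ht0 hisoa
        (fun z => resolvent b z - algebraMap ℂ (X →L[ℂ] X) z⁻¹) (fun z hz => ?_) fun z hz hne => ?_
      · have h1 : DifferentiableAt ℂ (fun z : ℂ => algebraMap ℂ (X →L[ℂ] X) z⁻¹) z := by
          simp only [Algebra.algebraMap_eq_smul_one]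
          exact (differentiableAt_inv (hkey z hz).1).smul_const _
        exact (differentiableAt_resolvent (hkey z hz).2).sub h1
      · have := (smul_resolvent_eq_of_mul_eq_zero hab0 hba0 (hkey z hz).1 (hkey z hz).2).2
          (hisoa z hz hne)
        rwa [hsum] at this
    have hfin' : FiniteDimensional ℂ
        (LinearMap.range ((rieszProjection a μ t : X →L[ℂ] X) : X →ₗ[ℂ] X)) := by
      rw [← rieszProjection_eq_of_le ht0 (min_le_left _ _) hiso]
      exact hfin
    refine ⟨⟨hμL, t, ht0, hisoL, ?_⟩, ?_⟩
    · rw [hproj]; exact hfin'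
    · rw [algebraicMultiplicity_eq ht0 hisoL, algebraicMultiplicity_eq ht0 hisoa, hproj]
  have e : ∀ T : X →L[ℂ] X, eigSum p T = ∑' μ : ℂ, {μ | IsDiscreteEigenvalue T μ}.indicator
      (fun μ => (algebraicMultiplicity T μ : ℝ≥0∞) * ENNReal.ofReal (‖μ‖ ^ p)) μ := fun T =>
    tsum_subtype {μ | IsDiscreteEigenvalue T μ}
      (fun μ => (algebraicMultiplicity T μ : ℝ≥0∞) * ENNReal.ofReal (‖μ‖ ^ p))
  rw [e, e]
  refine ENNReal.tsum_le_tsum fun μ => ?_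
  by_cases hμ0 : μ = 0
  · refine Set.indicator_apply_le' (fun _ => ?_) fun _ => zero_le
    rw [hμ0, norm_zero, Real.zero_rpow hp.ne', ENNReal.ofReal_zero, mul_zero]
    exact zero_le
  · refine Set.indicator_apply_le' (fun hμ => ?_) fun _ => zero_le
    obtain ⟨h1, h2⟩ := hdisc μ hμ0 hμ
    rw [Set.indicator_of_mem (show μ ∈ {μ | IsDiscreteEigenvalue L μ} from h1), h2]

end CompactSplitting

section Growth

variable {F G H : X →L[ℂ] X}

theorem trOn_add (hF : IsFiniteRank F) (hG : IsFiniteRank G) :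
    trOn (F + G) = trOn F + trOn G := by
  have i1 : FiniteDimensional ℂ (LinearMap.range (F : X →ₗ[ℂ] X)) := hF
  have i2 : FiniteDimensional ℂ (LinearMap.range (G : X →ₗ[ℂ] X)) := hG
  set Y := LinearMap.range (F : X →ₗ[ℂ] X) ⊔ LinearMap.range (G : X →ₗ[ℂ] X)
  have hFY : ∀ x, F x ∈ Y := fun x => Submodule.mem_sup_left ⟨x, rfl⟩
  have hGY : ∀ x, G x ∈ Y := fun x => Submodule.mem_sup_right ⟨x, rfl⟩
  have hY : ∀ x, (F + G) x ∈ Y := fun x => Y.add_mem (hFY x) (hGY x)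
  rw [trOn_eq_trace_restrict F Y hFY, trOn_eq_trace_restrict G Y hGY,
    trOn_eq_trace_restrict (F + G) Y hY, ← map_add]
  rfl

theorem trOn_smul (c : ℂ) (hF : IsFiniteRank F) : trOn (c • F) = c * trOn F := by
  have i1 : FiniteDimensional ℂ (LinearMap.range (F : X →ₗ[ℂ] X)) := hF
  set Y := LinearMap.range (F : X →ₗ[ℂ] X)
  have hFY : ∀ x, F x ∈ Y := fun x => ⟨x, rfl⟩
  have hY : ∀ x, (c • F) x ∈ Y := fun x => Y.smul_mem c (hFY x)
  rw [trOn_eq_trace_restrict F Y hFY, trOn_eq_trace_restrict (c • F) Y hY, ← smul_eq_mul,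
    ← map_smul]
  rfl

theorem trOn_mul_comm (S : X →L[ℂ] X) (hG : IsFiniteRank G) : trOn (S * G) = trOn (G * S) := by
  have i1 : FiniteDimensional ℂ (LinearMap.range (G : X →ₗ[ℂ] X)) := hG
  let C := (G : X →ₗ[ℂ] X).rangeRestrict
  let J := (LinearMap.range (G : X →ₗ[ℂ] X)).subtype
  rw [trOn_eq_trace_comp (S * G) C ((S : X →ₗ[ℂ] X) ∘ₗ J) rfl,
    trOn_eq_trace_comp (G * S) (C ∘ₗ (S : X →ₗ[ℂ] X)) J rfl]
  rfl

theorem exists_norm_trace_le (E : Type*) [NormedAddCommGroup E] [NormedSpace ℂ E]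
    [FiniteDimensional ℂ E] :
    ∃ C, 0 ≤ C ∧ ∀ f : E →L[ℂ] E, ‖LinearMap.trace ℂ E (f : E →ₗ[ℂ] E)‖ ≤ C * ‖f‖ :=
  let t : (E →L[ℂ] E) →L[ℂ] ℂ :=
    LinearMap.toContinuousLinearMap (LinearMap.trace ℂ E ∘ₗ ContinuousLinearMap.coeLM ℂ)
  ⟨‖t‖, t.opNorm_nonneg, t.le_opNorm⟩

theorem IsFiniteRank.exists_norm_trOn_mul_le (hG : IsFiniteRank G) :
    ∃ C, 0 ≤ C ∧ ∀ S : X →L[ℂ] X, ‖trOn (G * S)‖ ≤ C * ‖S‖ := by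
  have i1 : FiniteDimensional ℂ (LinearMap.range (G : X →ₗ[ℂ] X)) := hG
  obtain ⟨c, hc, htr⟩ := exists_norm_trace_le (LinearMap.range (G : X →ₗ[ℂ] X))
  let R := LinearMap.range (G : X →ₗ[ℂ] X)
  let C : X →L[ℂ] R := G.codRestrict R fun x => ⟨x, rfl⟩
  refine ⟨c * (‖C‖ * ‖R.subtypeL‖), by positivity, fun S => ?_⟩
  have h : trOn (G * S) =
      LinearMap.trace ℂ R ((C.comp (S.comp R.subtypeL) : R →L[ℂ] R) : R →ₗ[ℂ] R) :=
    trOn_eq_trace_comp (G * S) ((C : X →ₗ[ℂ] R) ∘ₗ (S : X →ₗ[ℂ] X)) R.subtype rfl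
  rw [h]
  calc _ ≤ c * ‖C.comp (S.comp R.subtypeL)‖ := htr _
    _ ≤ c * (‖C‖ * (‖S‖ * ‖R.subtypeL‖)) := by
      gcongr
      refine (ContinuousLinearMap.opNorm_comp_le _ _).trans ?_
      gcongr
      exact ContinuousLinearMap.opNorm_comp_le _ _
    _ = _ := by ring

theorem IsFiniteRank.pow {k : ℕ} (hF : IsFiniteRank F) (hk : 1 ≤ k) : IsFiniteRank (F ^ k) := by
  obtain ⟨j, rfl⟩ := Nat.exists_eq_add_of_le' hk
  rw [pow_succ]
  exact hF.mul_left _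

/-- If two finite rank operators differ by a small multiple of a fixed finite rank operator, then
the traces of their powers differ by a controlled amount. -/
theorem IsFiniteRank.exists_norm_trOn_pow_sub_le (hG : IsFiniteRank G) {M : ℝ} (hM : 0 ≤ M)
    (k : ℕ) : ∃ C, 0 ≤ C ∧ ∀ (A B : X →L[ℂ] X) (c : ℂ), IsFiniteRank A → IsFiniteRank B →
      ‖A‖ ≤ M → ‖B‖ ≤ M → ‖c‖ ≤ 2 → A - B = c • G →
      ‖trOn (A ^ (k + 1)) - trOn (B ^ (k + 1))‖ ≤ C := by
  obtain ⟨C₀, hC₀, h₀⟩ := hG.exists_norm_trOn_mul_le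
  have key : ∀ j : ℕ, ∀ (A B : X →L[ℂ] X) (c : ℂ) (S : X →L[ℂ] X),
      ‖A‖ ≤ M → ‖B‖ ≤ M → ‖c‖ ≤ 2 → A - B = c • G →
      IsFiniteRank (S * (A ^ j - B ^ j)) ∧
      ‖trOn (S * (A ^ j - B ^ j))‖ ≤ 2 * C₀ * j * M ^ (j - 1) * ‖S‖ := by
    intro j
    induction j with
    | zero =>
      intro A B c S _ _ _ _
      have e : S * (A ^ 0 - B ^ 0) = (0 : ℂ) • 0 := by simp
      rw [e, trOn_smul 0 isFiniteRank_zero]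
      exact ⟨isFiniteRank_zero.smul 0, by simp⟩
    | succ j ih =>
      intro A B c S hA hB hc h
      obtain ⟨i1, i2⟩ := ih A B c (S * A) hA hB hc h
      have e : S * (A ^ (j + 1) - B ^ (j + 1)) =
          S * A * (A ^ j - B ^ j) + c • (S * (G * B ^ j)) := by
        have : c • (S * (G * B ^ j)) = S * ((A - B) * B ^ j) := by
          rw [h, smul_mul_assoc, mul_smul_comm]
        rw [this, pow_succ', pow_succ' B]
        noncomm_ring
      have f1 : IsFiniteRank (S * (G * B ^ j)) := (hG.mul_right _).mul_left _
      rw [e, trOn_add i1 (f1.smul c), trOn_smul c f1, trOn_mul_comm S (hG.mul_right _), mul_assoc G]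
      refine ⟨i1.add (f1.smul c), ?_⟩
      have hBj : ‖B ^ j‖ ≤ M ^ j := by
        rcases Nat.eq_zero_or_pos j with rfl | hj
        · rw [pow_zero, pow_zero]; exact ContinuousLinearMap.norm_id_le
        · exact (norm_pow_le' B hj).trans (by gcongr)
      calc _ ≤ ‖trOn (S * A * (A ^ j - B ^ j))‖ + ‖c‖ * ‖trOn (G * (B ^ j * S))‖ := by
            rw [← norm_mul]; exact norm_add_le _ _
        _ ≤ 2 * C₀ * j * M ^ (j - 1) * (‖S‖ * M) + 2 * (C₀ * (M ^ j * ‖S‖)) := by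
            refine add_le_add (i2.trans ?_) ?_
            · gcongr
              exact (norm_mul_le _ _).trans (by gcongr)
            · gcongr
              refine (h₀ _).trans ?_
              gcongr
              exact (norm_mul_le _ _).trans (by gcongr)
        _ = _ := by
            rcases j with _ | j
            · simp; ring
            · simp only [Nat.add_sub_cancel, pow_succ]; push_cast; ring
  refine ⟨2 * C₀ * (k + 1 : ℕ) * M ^ k * ‖(1 : X →L[ℂ] X)‖, by positivity, ?_⟩
  intro A B c hA hB hAM hBM hc h
  obtain ⟨i1, i2⟩ := key (k + 1) A B c 1 hAM hBM hc h
  rw [one_mul] at i1 i2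
  have e : trOn (A ^ (k + 1)) = trOn (A ^ (k + 1) - B ^ (k + 1)) + trOn (B ^ (k + 1)) := by
    rw [← trOn_add i1 (hB.pow (by omega)), sub_add_cancel]
  rw [e, add_sub_cancel_right]
  simpa using i2

theorem differentiable_det_smul_add {E : Type*} [NormedAddCommGroup E] [NormedSpace ℂ E]
    [FiniteDimensional ℂ E] (P Q : E →ₗ[ℂ] E) :
    Differentiable ℂ fun v : ℂ => LinearMap.det (v • P + Q) := fun _ =>
  DifferentiableAt.linearMap_det
    (f := fun w => w • LinearMap.toContinuousLinearMap P + LinearMap.toContinuousLinearMap Q)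
    ((differentiableAt_id.smul_const _).add_const _)

/-- After multiplication by a power of `v`, the determinant of `1 - z (v⁻¹ G + H)` extends to an
entire function of `v`. -/
theorem exists_entire_detOneSub (hG : IsFiniteRank G) (hH : IsFiniteRank H) (z : ℂ) :
    ∃ ψ : ℂ → ℂ, Differentiable ℂ ψ ∧ ∀ v : ℂ, v ≠ 0 → ψ v =
      v ^ Module.finrank ℂ (LinearMap.range (G : X →ₗ[ℂ] X)) *
        detOneSub (z • (v⁻¹ • G + H)) := by
  have i1 : FiniteDimensional ℂ (LinearMap.range (G : X →ₗ[ℂ] X)) := hG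
  have i2 : FiniteDimensional ℂ (LinearMap.range (H : X →ₗ[ℂ] X)) := hH
  let U := LinearMap.range (G : X →ₗ[ℂ] X)
  let W := LinearMap.range (H : X →ₗ[ℂ] X)
  let C : X →ₗ[ℂ] U × W := (G : X →ₗ[ℂ] X).rangeRestrict.prod (H : X →ₗ[ℂ] X).rangeRestrict
  let J : U × W →ₗ[ℂ] X := U.subtype.coprod W.subtype
  let D : ℂ → (U × W →ₗ[ℂ] U × W) := fun v =>
    (v • (LinearMap.id : U →ₗ[ℂ] U)).prodMap (LinearMap.id : W →ₗ[ℂ] W)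
  refine ⟨fun v => LinearMap.det (D v - z • (C ∘ₗ J)), fun v => ?_, fun v hv => ?_⟩
  · refine (differentiable_det_smul_add (LinearMap.inl ℂ U W ∘ₗ LinearMap.fst ℂ U W)
      (LinearMap.inr ℂ U W ∘ₗ LinearMap.snd ℂ U W - z • (C ∘ₗ J)) v).congr_of_eventuallyEq
      (Filter.Eventually.of_forall fun w => ?_)
    dsimp only
    congr 1
    refine LinearMap.ext fun x => ?_
    simp [D, Prod.ext_iff, sub_eq_add_neg]
  · have e : ((z • (v⁻¹ • G + H) : X →L[ℂ] X) : X →ₗ[ℂ] X) = J ∘ₗ (z • (D v⁻¹ ∘ₗ C)) := by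
      ext x; simp [J, D, C]
    rw [detOneSub_eq_det_comp _ _ _ e]
    have hdet : LinearMap.det (D v) = v ^ Module.finrank ℂ U := by
      simp only [D]
      rw [LinearMap.det_prodMap, LinearMap.det_smul]; simp
    rw [← hdet, ← LinearMap.det_comp]
    dsimp only
    congr 1
    refine LinearMap.ext fun x => ?_
    simp [D, Prod.ext_iff, smul_sub, smul_smul, mul_left_comm v z, hv]

end Growth

section IdealEstimates

variable {p : ℝ} (I : LpIdeal p X) {K L : X →L[ℂ] X}

theorem LpIdeal.sub_mem (hK : K ∈ I.carrier) (hL : L ∈ I.carrier) : K - L ∈ I.carrier := by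
  have : K - L = K + (-1 : ℂ) • L := by rw [neg_one_smul, sub_eq_add_neg]
  rw [this]
  exact I.add_mem hK (I.smul_mem _ hL)

theorem LpIdeal.norm'_sub_le (hK : K ∈ I.carrier) (hL : L ∈ I.carrier) :
    I.norm' (K - L) ≤ I.q * (I.norm' K + I.norm' L) := by
  have : K - L = K + (-1 : ℂ) • L := by rw [neg_one_smul, sub_eq_add_neg]
  rw [this]
  refine (I.norm'_add_le K hK _ (I.smul_mem _ hL)).trans_eq ?_
  rw [I.norm'_smul L hL]; simp

theorem LpIdeal.norm'_sub_comm (hK : K ∈ I.carrier) (hL : L ∈ I.carrier) :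
    I.norm' (K - L) = I.norm' (L - K) := by
  have : K - L = (-1 : ℂ) • (L - K) := by rw [neg_one_smul, neg_sub]
  rw [this, I.norm'_smul _ (I.sub_mem hL hK)]; simp

theorem trOn_smul_pow {F : X →L[ℂ] X} (hF : IsFiniteRank F) (z : ℂ) {k : ℕ} (hk : 1 ≤ k) :
    trOn ((z • F) ^ k) = z ^ k * trOn (F ^ k) := by
  rw [smul_pow, trOn_smul _ (hF.pow hk)]

theorem detp_smul {F : X →L[ℂ] X} (hF : IsFiniteRank F) (z : ℂ) :
    detp p (z • F) = detOneSub (z • F) *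
      Complex.exp (∑ k ∈ Finset.Icc 1 (⌈p⌉₊ - 1), trOn (F ^ k) / (k : ℂ) * z ^ k) := by
  unfold detp
  congr 2
  refine Finset.sum_congr rfl fun k hk => ?_
  rw [trOn_smul_pow hF z (Finset.mem_Icc.mp hk).1]
  ring

variable (hp : 0 < p) {Γ : ℝ} (hΓ : 0 < Γ)
  (hΓb : ∀ F : X →L[ℂ] X, IsFiniteRank F → ‖detp p F‖ ≤ Real.exp (Γ * (eigSum p F).toReal))

include hp hΓ hΓb

theorem LpIdeal.norm_detp_le {F : X →L[ℂ] X} (hF : IsFiniteRank F) {t : ℝ}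
    (ht : I.norm' F ≤ t) : ‖detp p F‖ ≤ Real.exp (Γ * (I.γ * t) ^ p) := by
  have hm := I.finiteRank_mem F hF
  have h0 := I.norm'_nonneg F hm
  have hγ := I.γ_nonneg
  have ht0 := h0.trans ht
  refine (hΓb F hF).trans (Real.exp_le_exp.mpr ?_)
  gcongr
  refine ENNReal.toReal_le_of_le_ofReal (by positivity) ((I.eig_le F hm).trans ?_)
  exact ENNReal.ofReal_le_ofReal (by gcongr)

theorem LpIdeal.exists_growth (hL : L ∈ I.carrier) {ε : ℝ} (hε : 0 < ε) :
    ∃ C, 0 ≤ C ∧ ∃ η, 0 < η ∧ ∀ F : X →L[ℂ] X, IsFiniteRank F → I.norm' (F - L) < η → ∀ z : ℂ,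
      ‖detp p (z • F)‖ ≤ Real.exp (ε * ‖z‖ ^ p + C * (1 + ‖z‖) ^ (⌈p⌉₊ - 1)) := by
  set d := ⌈p⌉₊ - 1
  have hq := I.one_le_q
  have hγ := I.γ_nonneg
  set t : ℝ := (ε / Γ) ^ (1 / p) / (I.γ + 1)
  have ht : 0 < t := by positivity
  have htp : Γ * (I.γ * t) ^ p ≤ ε := by
    have h1 : I.γ * t ≤ (ε / Γ) ^ (1 / p) := by
      have : I.γ * t = (ε / Γ) ^ (1 / p) * (I.γ / (I.γ + 1)) := by simp only [t]; ring
      rw [this]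
      exact mul_le_of_le_one_right (by positivity) ((div_le_one (by positivity)).mpr (by linarith))
    calc Γ * (I.γ * t) ^ p ≤ Γ * ((ε / Γ) ^ (1 / p)) ^ p := by gcongr
      _ = ε := by
        rw [← Real.rpow_mul (by positivity), one_div_mul_cancel hp.ne', Real.rpow_one]
        field_simp
  set η : ℝ := t / (4 * I.q ^ 2)
  have hη : 0 < η := by positivity
  obtain ⟨G, hG, hGL⟩ := I.dense_finiteRank L hL η hη
  have hGm := I.finiteRank_mem G hG
  have hG0 := I.norm'_nonneg G hGm
  set ρ : ℝ := min 1 (t / (2 * I.q * (I.norm' G + 1)))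
  have hρ : 0 < ρ := lt_min one_pos (by positivity)
  have hρ1 : ρ ≤ 1 := min_le_left _ _
  have hρG : I.q * (ρ * I.norm' G) ≤ t / 2 := by
    have h1 : ρ * (I.norm' G + 1) ≤ t / (2 * I.q) := by
      calc ρ * (I.norm' G + 1) ≤ t / (2 * I.q * (I.norm' G + 1)) * (I.norm' G + 1) := by
            gcongr; exact min_le_right _ _
        _ = t / (2 * I.q) := by field_simp
    calc I.q * (ρ * I.norm' G) ≤ I.q * (t / (2 * I.q)) := by
          gcongr; exact le_trans (by gcongr; linarith) h1
      _ = t / 2 := by field_simp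
  set M : ℝ := ‖G‖ + I.q * (η + η)
  have hM : 0 ≤ M := by positivity
  choose c hc0 hc using fun k : ℕ => hG.exists_norm_trOn_pow_sub_le hM k
  set N := Module.finrank ℂ (LinearMap.range (G : X →ₗ[ℂ] X))
  have hlog : 0 ≤ Real.log ρ⁻¹ := Real.log_nonneg ((one_le_inv₀ hρ).mpr hρ1)
  refine ⟨∑ k ∈ Finset.Icc 1 d, c (k - 1) + N * Real.log ρ⁻¹,
    add_nonneg (Finset.sum_nonneg fun k _ => hc0 _) (by positivity), η, hη, fun F hF hFL z => ?_⟩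
  have hFm := I.finiteRank_mem F hF
  set H := F - G with hHdef
  have hH : IsFiniteRank H := hF.sub hG
  have hHm := I.finiteRank_mem H hH
  have hHn : I.norm' H ≤ I.q * (η + η) := by
    have e : H = (F - L) + (L - G) := by rw [hHdef]; abel
    rw [e]
    refine (I.norm'_add_le _ (I.sub_mem hFm hL) _ (I.sub_mem hL hGm)).trans ?_
    gcongr
  have hHop : ‖H‖ ≤ I.q * (η + η) := (I.opNorm_le H hHm).trans hHn
  have hFGH : F = G + H := by rw [hHdef]; abel
  have hFM : ‖F‖ ≤ M := by rw [hFGH]; exact (norm_add_le _ _).trans (add_le_add le_rfl hHop)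
  obtain ⟨ψ, hψ, hψe⟩ := exists_entire_detOneSub hG hH z
  set SF := ∑ k ∈ Finset.Icc 1 d, trOn (F ^ k) / (k : ℂ) * z ^ k
  have h1 : detp p (z • F) = ψ 1 * Complex.exp SF := by
    rw [detp_smul hF, hψe 1 one_ne_zero, inv_one, one_smul, ← hFGH]; simp [SF, d]
  rw [h1]
  refine norm_le_of_sphere (f := fun v => ψ v * Complex.exp SF) (inv_pos.mpr hρ)
    (fun v _ => (hψ v).mul_const _) (fun v hv => ?_) 1 (by
      rw [norm_one]; exact (one_le_inv₀ hρ).mpr hρ1)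
  have hv0 : v ≠ 0 := by
    rintro rfl; rw [norm_zero] at hv; exact (inv_pos.mpr hρ).ne hv
  have hvi : ‖v⁻¹‖ = ρ := by rw [norm_inv, hv, inv_inv]
  set B := v⁻¹ • G + H
  have hB : IsFiniteRank B := (hG.smul _).add hH
  have hBm := I.finiteRank_mem B hB
  have hBn : I.norm' B ≤ t := by
    calc I.norm' B ≤ I.q * (I.norm' (v⁻¹ • G) + I.norm' H) :=
          I.norm'_add_le _ (I.smul_mem _ hGm) _ hHm
      _ ≤ I.q * (ρ * I.norm' G + I.q * (η + η)) := by
          rw [I.norm'_smul G hGm, hvi]; gcongr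
      _ = I.q * (ρ * I.norm' G) + t / 2 := by simp only [η]; field_simp; ring
      _ ≤ t := by linarith
  have hBM : ‖B‖ ≤ M := by
    refine (norm_add_le _ _).trans (add_le_add ?_ hHop)
    rw [norm_smul, hvi]; exact mul_le_of_le_one_left (norm_nonneg _) hρ1
  have hAB : F - B = (1 - v⁻¹) • G := by
    rw [hFGH]; simp only [B]; rw [sub_smul, one_smul]; abel
  have hv2 : ‖1 - v⁻¹‖ ≤ 2 := by
    refine (norm_sub_le _ _).trans ?_
    rw [norm_one, hvi]; linarith
  set SB := ∑ k ∈ Finset.Icc 1 d, trOn (B ^ k) / (k : ℂ) * z ^ k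
  have e1 : ψ v * Complex.exp SF = v ^ N * (detp p (z • B) * Complex.exp (SF - SB)) := by
    have eB : detp p (z • B) = detOneSub (z • B) * Complex.exp SB := detp_smul hB z
    have := Complex.exp_ne_zero SB
    rw [hψe v hv0, eB, Complex.exp_sub]
    change v ^ N * detOneSub (z • B) * _ = _
    field_simp
  have e2 : ‖SF - SB‖ ≤ (∑ k ∈ Finset.Icc 1 d, c (k - 1)) * (1 + ‖z‖) ^ d := by
    rw [← Finset.sum_sub_distrib, Finset.sum_mul]
    refine norm_sum_le_of_le _ fun k hk => ?_
    obtain ⟨hk1, hkd⟩ := Finset.mem_Icc.mp hk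
    obtain ⟨j, rfl⟩ := Nat.exists_eq_add_of_le' hk1
    have hk0 : (1 : ℝ) ≤ ((j + 1 : ℕ) : ℝ) := by exact_mod_cast hk1
    rw [← sub_mul, ← sub_div, norm_mul, norm_div, norm_pow, Complex.norm_natCast]
    refine mul_le_mul ?_ ?_ (by positivity) (hc0 _)
    · exact (div_le_self (norm_nonneg _) hk0).trans (hc j F B _ hF hB hFM hBM hv2 hAB)
    · calc ‖z‖ ^ (j + 1) ≤ (1 + ‖z‖) ^ (j + 1) := by gcongr; linarith
        _ ≤ (1 + ‖z‖) ^ d := pow_le_pow_right₀ (by linarith [norm_nonneg z]) hkd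
  have e3 : ‖detp p (z • B)‖ ≤ Real.exp (ε * ‖z‖ ^ p) := by
    refine (I.norm_detp_le hp hΓ hΓb (hB.smul z) (t := ‖z‖ * t) ?_).trans
      (Real.exp_le_exp.mpr ?_)
    · rw [I.norm'_smul B hBm]; gcongr
    · rw [mul_left_comm, Real.mul_rpow (norm_nonneg _) (by positivity), mul_left_comm, mul_comm]
      gcongr
  have e4 : ‖v ^ N‖ ≤ Real.exp (N * Real.log ρ⁻¹ * (1 + ‖z‖) ^ d) := by
    rw [norm_pow, hv]
    calc ρ⁻¹ ^ N = Real.exp (N * Real.log ρ⁻¹) := by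
          rw [Real.exp_nat_mul, Real.exp_log (inv_pos.mpr hρ)]
      _ ≤ _ := Real.exp_le_exp.mpr (le_mul_of_one_le_right (by positivity)
          (one_le_pow₀ (by linarith [norm_nonneg z])))
  rw [e1, norm_mul, norm_mul]
  calc _ ≤ Real.exp (N * Real.log ρ⁻¹ * (1 + ‖z‖) ^ d) * (Real.exp (ε * ‖z‖ ^ p) *
        Real.exp ((∑ k ∈ Finset.Icc 1 d, c (k - 1)) * (1 + ‖z‖) ^ d)) := by
        gcongr
        exact (Complex.norm_exp_le_exp_norm _).trans (Real.exp_le_exp.mpr e2)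
    _ = _ := by
        rw [← Real.exp_add, ← Real.exp_add]; congr 1; ring

/-- The regularized determinant is Lipschitz on bounded sets of finite rank operators. -/
theorem LpIdeal.exists_norm_detp_sub_le (N : ℝ) : ∃ B, 0 ≤ B ∧ ∀ F F' : X →L[ℂ] X,
    IsFiniteRank F → IsFiniteRank F' → I.norm' F ≤ N → I.norm' (F' - F) < 1 →
    ‖detp p F' - detp p F‖ ≤ B * I.norm' (F' - F) := by
  have hq := I.one_le_q
  set B := Real.exp (Γ * (I.γ * (I.q * (N + 1))) ^ p)
  refine ⟨2 * B, by positivity, fun F F' hF hF' hN h => ?_⟩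
  have hFm := I.finiteRank_mem F hF
  set D := F' - F with hD
  have hDf : IsFiniteRank D := hF'.sub hF
  have hDm := I.finiteRank_mem D hDf
  have hFD : F' = F + (1 : ℂ) • D := by rw [hD]; simp
  rcases (I.norm'_nonneg D hDm).eq_or_lt with h0 | h0
  · have : D = 0 := (I.norm'_eq_zero_iff D hDm).mp h0.symm
    rw [← h0, hFD, this]; simp
  have i1 : FiniteDimensional ℂ (LinearMap.range (F : X →ₗ[ℂ] X)) := hF
  have i2 : FiniteDimensional ℂ (LinearMap.range (D : X →ₗ[ℂ] X)) := hDf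
  set Y := LinearMap.range (F : X →ₗ[ℂ] X) ⊔ LinearMap.range (D : X →ₗ[ℂ] X)
  have hFY : ∀ x, F x ∈ Y := fun x => Submodule.mem_sup_left ⟨x, rfl⟩
  have hDY : ∀ x, D x ∈ Y := fun x => Submodule.mem_sup_right ⟨x, rfl⟩
  have hY : ∀ w : ℂ, ∀ x, (F + w • D) x ∈ Y := fun w x => Y.add_mem (hFY x) (Y.smul_mem w (hDY x))
  have hdiff : Differentiable ℂ fun w : ℂ => detp p (F + w • D) := by
    intro w
    have e : (fun w : ℂ => detp p (F + w • D)) = fun w : ℂ => regDet (⌈p⌉₊ - 1)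
        ((LinearMap.toContinuousLinearMap
            ((F : X →ₗ[ℂ] X).restrict (p := Y) (q := Y) fun x _ => hFY x) +
          w • LinearMap.toContinuousLinearMap
            ((D : X →ₗ[ℂ] X).restrict (p := Y) (q := Y) fun x _ => hDY x) : Y →L[ℂ] Y) :
              Y →ₗ[ℂ] Y) := by
      funext w
      rw [detp_eq_regDet_restrict p (F + w • D) Y (hY w)]
      congr 1
    rw [e]
    exact DifferentiableAt.regDet _ ((differentiableAt_id.smul_const _).const_add _)
  have hbound : ∀ w : ℂ, ‖w‖ ≤ (I.norm' D)⁻¹ → ‖detp p (F + w • D)‖ ≤ B := by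
    intro w hw
    refine I.norm_detp_le hp hΓ hΓb (hF.add (hDf.smul w)) ?_
    refine (I.norm'_add_le F hFm _ (I.smul_mem _ hDm)).trans ?_
    rw [I.norm'_smul D hDm]
    have : ‖w‖ * I.norm' D ≤ 1 := by
      calc ‖w‖ * I.norm' D ≤ (I.norm' D)⁻¹ * I.norm' D := by gcongr
        _ = 1 := inv_mul_cancel₀ h0.ne'
    gcongr
  have hR : 0 < (I.norm' D)⁻¹ := inv_pos.mpr h0
  have hmaps : Set.MapsTo (fun w : ℂ => detp p (F + w • D)) (Metric.ball 0 (I.norm' D)⁻¹)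
      (Metric.closedBall (detp p (F + (0 : ℂ) • D)) (2 * B)) := by
    intro w hw
    rw [Metric.mem_closedBall, dist_eq_norm]
    refine (norm_sub_le _ _).trans ?_
    have := hbound w (by simpa using (Metric.mem_ball.mp hw).le)
    have := hbound 0 (by simpa using hR.le)
    linarith
  have := Complex.dist_le_div_mul_dist_of_mapsTo_ball (z := 1) hdiff.differentiableOn hmaps
    (by simpa using (one_lt_inv₀ h0).mpr h)
  rw [dist_eq_norm, dist_zero_right, norm_one, mul_one, zero_smul, add_zero, ← hFD, div_inv_eq_mul]
    at this
  exact this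

end IdealEstimates

section ApproximateBound

variable {p : ℝ} {L : X →L[ℂ] X}

/-- The nonzero part of the spectrum of a finite rank operator, as a multiset. -/
theorem exists_roots (F : X →L[ℂ] X) (Y : Submodule ℂ X) [FiniteDimensional ℂ Y]
    (hY : ∀ x, F x ∈ Y) : ∃ s : Multiset ℂ, (∀ a ∈ s, ∃ v ∈ Y, v ≠ 0 ∧ F v = a • v) ∧
      (∀ z : ℂ, detOneSub (z • F) = (s.map fun a => 1 - z * a).prod) ∧
      ∀ k, 1 ≤ k → trOn (F ^ k) = (s.map fun a => a ^ k).sum := by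
  set B : Module.End ℂ Y := (F : X →ₗ[ℂ] X).restrict (p := Y) (q := Y) fun x _ => hY x with hB
  refine ⟨B.charpoly.roots, fun a ha => ?_, fun z => ?_, fun k hk => ?_⟩
  · obtain ⟨v, hv⟩ := (hasEigenvalue_of_mem_roots ha).exists_hasEigenvector
    refine ⟨v, v.2, fun h => hv.2 (Subtype.ext h), ?_⟩
    exact congrArg Subtype.val hv.apply_eq_smul
  · rw [detOneSub_eq_det_restrict (z • F) Y fun x => Y.smul_mem z (hY x),
      ← det_one_sub_smul_eq_prod_roots]
    rfl
  · rw [trOn_pow_eq_trace_restrict F Y hY hk, trace_pow_eq_sum_roots]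

theorem detp_one (F : X →L[ℂ] X) : detp 1 F = detOneSub F := by
  simp [detp]

/-- Splitting off an invariant finite-dimensional part: the remaining factor of the regularized
determinant is close to one, by the growth of the full determinant. -/
theorem norm_detp_le_of_splitting {P F' : X →L[ℂ] X} (hP : IsFiniteRank P)
    (hPP : P * P = P) (hLP : Commute L P) (hF' : IsFiniteRank F') (h1 : P * F' = 0)
    (h2 : F' * P = 0) {ρ M : ℝ} (hρ : 2 ≤ ρ) (hM : 0 < M)
    (hlarge : ∀ (μ : ℂ) (v : X), v ≠ 0 → P v = v → L v = μ • v → ρ⁻¹ < ‖μ‖)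
    {k : ℕ} (hsmall : ‖F' ^ k‖ < ρ⁻¹ ^ k)
    (hgrowth : ∀ z : ℂ, ‖z‖ ≤ 2 * ρ → ‖detp p (z • (P * L + F'))‖ ≤ Real.exp M) :
    ‖detp p (P * L + F')‖ ≤ ‖detp p (P * L)‖ *
      Real.exp (2 * M * (4 / ρ) ^ (⌈p⌉₊ - 1 + 1) +
        M / Real.log 2 * (2 * (1 / ρ) ^ (⌈p⌉₊ - 1 + 1))) := by
  have hρ0 : 0 < ρ := by linarith
  have hPL : IsFiniteRank (P * L) := hP.mul_right L
  have i1 : FiniteDimensional ℂ (LinearMap.range (P : X →ₗ[ℂ] X)) := hP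
  have i2 : FiniteDimensional ℂ (LinearMap.range (F' : X →ₗ[ℂ] X)) := hF'
  have m1 : P * L * F' = 0 := by rw [← hLP.eq, mul_assoc, h1, mul_zero]
  have m2 : F' * (P * L) = 0 := by rw [← mul_assoc, h2, zero_mul]
  obtain ⟨N, hN, hNd, -⟩ := exists_roots (P * L) (LinearMap.range (P : X →ₗ[ℂ] X))
    fun x => ⟨L x, rfl⟩
  obtain ⟨U, hU, hUd, hUt⟩ := exists_roots F' (LinearMap.range (F' : X →ₗ[ℂ] X))
    fun x => ⟨x, rfl⟩
  have hUρ : ∀ u ∈ U, ‖u‖ * ρ < 1 := by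
    intro u hu
    obtain ⟨v, -, hv0, hv⟩ := hU u hu
    have hpow : ∀ j : ℕ, (F' ^ j) v = u ^ j • v := by
      intro j
      induction j with
      | zero => simp
      | succ j ih => rw [pow_succ', mul_apply_eq_comp, ih, map_smul, hv, smul_smul, pow_succ]
    have h3 : ‖u‖ ^ k ≤ ‖F' ^ k‖ := by
      have := (F' ^ k).le_opNorm v
      rw [hpow, norm_smul, norm_pow] at this
      exact le_of_mul_le_mul_right this (norm_pos_iff.mpr hv0)
    have h4 : ‖u‖ < ρ⁻¹ :=
      lt_of_pow_lt_pow_left₀ k (inv_nonneg.mpr hρ0.le) (h3.trans_lt hsmall)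
    calc ‖u‖ * ρ < ρ⁻¹ * ρ := by gcongr
      _ = 1 := inv_mul_cancel₀ hρ0.ne'
  have hNρ : ∀ μ ∈ N, 1 < ‖μ‖ * ρ := by
    intro μ hμ
    obtain ⟨v, ⟨x, hx⟩, hv0, hv⟩ := hN μ hμ
    have hPv : P v = v := by
      rw [← hx]; exact congrArg (fun T : X →L[ℂ] X => T x) hPP
    have hLv : L v = μ • v := by
      rw [← hv, ← hLP.eq, mul_apply_eq_comp, hPv]
    calc 1 = ρ⁻¹ * ρ := (inv_mul_cancel₀ hρ0.ne').symm
      _ < ‖μ‖ * ρ := by gcongr; exact hlarge μ v hv0 hPv hLv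
  have hFt : IsFiniteRank (P * L + F') := hPL.add hF'
  have hfac : ∀ z : ℂ, detp p (z • (P * L + F')) = (N.map fun μ => 1 - z * μ).prod *
      ((U.map fun u => 1 - z * u).prod * Complex.exp (∑ k ∈ Finset.Icc 1 (⌈p⌉₊ - 1),
        trOn ((P * L + F') ^ k) / (k : ℂ) * z ^ k)) := by
    intro z
    rw [detp_smul hFt, smul_add, ← detp_one, detp_add_of_mul_eq_zero 1 (hPL.smul z) (hF'.smul z)
      (by rw [smul_mul_smul_comm, m1, smul_zero]) (by rw [smul_mul_smul_comm, m2, smul_zero]),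
      detp_one, detp_one, hNd, hUd, mul_assoc]
  have key := norm_prod_small_le (c := fun k => trOn ((P * L + F') ^ k) / (k : ℂ)) hρ hM hUρ hNρ
    (fun z hz => by rw [← hfac]; exact hgrowth z (by linarith))
    (fun z hz => by rw [← hfac]; exact hgrowth z hz.le)
  rw [detp_add_of_mul_eq_zero p hPL hF' m1 m2, norm_mul]
  refine mul_le_mul_of_nonneg_left ?_ (norm_nonneg _)
  refine le_of_eq_of_le (congrArg _ ?_) key
  unfold detp
  congr 1
  · simpa using hUd 1
  · congr 1
    exact Finset.sum_congr rfl fun k hk => by rw [hUt k (Finset.mem_Icc.mp hk).1]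

variable (I : LpIdeal p X) (hp : 0 < p) {Γ : ℝ} (hΓ : 0 < Γ)
  (hΓb : ∀ F : X →L[ℂ] X, IsFiniteRank F → ‖detp p F‖ ≤ Real.exp (Γ * (eigSum p F).toReal))

include hp hΓ hΓb

/-- The exponents produced by the growth estimate are negligible for large `ρ`. -/
theorem LpIdeal.exists_small_growth (hL : L ∈ I.carrier) {τ : ℝ} (hτ : 0 < τ) :
    ∃ ρ₀, 2 ≤ ρ₀ ∧ ∃ η, 0 < η ∧ ∀ ρ, ρ₀ ≤ ρ → ∃ M, 0 < M ∧
      2 * M * (4 / ρ) ^ (⌈p⌉₊ - 1 + 1) + M / Real.log 2 * (2 * (1 / ρ) ^ (⌈p⌉₊ - 1 + 1)) ≤ τ ∧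
      ∀ F : X →L[ℂ] X, IsFiniteRank F → I.norm' (F - L) < η → ∀ z : ℂ, ‖z‖ ≤ 2 * ρ →
        ‖detp p (z • F)‖ ≤ Real.exp M := by
  set d := ⌈p⌉₊ - 1 with hd
  have hpd : p ≤ (d + 1 : ℕ) := by
    have h1 : 1 ≤ ⌈p⌉₊ := Nat.one_le_ceil_iff.mpr hp
    have : d + 1 = ⌈p⌉₊ := by omega
    rw [this]; exact Nat.le_ceil p
  have hlog : 0 < Real.log 2 := Real.log_pos one_lt_two
  set A : ℝ := 2 * 4 ^ (d + 1) + 2 / Real.log 2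
  have hA : 0 < A := by positivity
  set ε : ℝ := τ / (2 * A * 2 ^ (d + 1))
  have hε : 0 < ε := by positivity
  obtain ⟨C, hC, η, hη, hgr⟩ := I.exists_growth hp hΓ hΓb hL hε
  refine ⟨max 2 (2 * A * C * 3 ^ d / τ), le_max_left _ _, η, hη, fun ρ hρ => ?_⟩
  have hρ2 : 2 ≤ ρ := (le_max_left _ _).trans hρ
  have hρC : 2 * A * C * 3 ^ d / τ ≤ ρ := (le_max_right _ _).trans hρ
  have hρ0 : 0 < ρ := by linarith
  refine ⟨ε * (2 * ρ) ^ (d + 1) + C * (3 * ρ) ^ d, by positivity, ?_, fun F hF hFL z hz => ?_⟩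
  · have e : 2 * (ε * (2 * ρ) ^ (d + 1) + C * (3 * ρ) ^ d) * (4 / ρ) ^ (d + 1) +
        (ε * (2 * ρ) ^ (d + 1) + C * (3 * ρ) ^ d) / Real.log 2 * (2 * (1 / ρ) ^ (d + 1)) =
        A * ε * 2 ^ (d + 1) + A * C * 3 ^ d / ρ := by
      simp only [A, div_pow, mul_pow, one_pow, pow_succ]
      field_simp
    rw [e]
    have e1 : A * ε * 2 ^ (d + 1) = τ / 2 := by
      simp only [ε]; field_simp
    have e2 : A * C * 3 ^ d / ρ ≤ τ / 2 := by
      rw [div_le_iff₀ hτ] at hρC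
      rw [div_le_iff₀ hρ0]; linarith
    linarith
  · refine (hgr F hF hFL z).trans (Real.exp_le_exp.mpr ?_)
    have h1 : ‖z‖ ^ p ≤ (2 * ρ) ^ (d + 1) := by
      calc ‖z‖ ^ p ≤ (2 * ρ) ^ p := by gcongr
        _ ≤ (2 * ρ) ^ ((d + 1 : ℕ) : ℝ) := Real.rpow_le_rpow_of_exponent_le (by linarith) hpd
        _ = _ := Real.rpow_natCast _ _
    gcongr
    linarith

/-- The determinant bound holds, up to an arbitrarily small error, with the ideal norm of an
operator which is approximated by finite rank operators. -/
theorem LpIdeal.exists_norm_detp_le_add (hL : L ∈ I.carrier) {ε : ℝ} (hε : 0 < ε) :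
    ∃ η, 0 < η ∧ ∀ F : X →L[ℂ] X, IsFiniteRank F → I.norm' (F - L) < η →
      ‖detp p F‖ ≤ Real.exp (Γ * (I.γ * I.norm' L) ^ p) + ε := by
  have hq := I.one_le_q
  have hγ := I.γ_nonneg
  have hn := I.norm'_nonneg L hL
  set B := Real.exp (Γ * (I.γ * I.norm' L) ^ p)
  have hB : 0 < B := Real.exp_pos _
  set τ := Real.log (1 + ε / (2 * B))
  have hτ : 0 < τ := Real.log_pos (lt_add_of_pos_right _ (by positivity))
  have hBτ : B * Real.exp τ = B + ε / 2 := by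
    rw [Real.exp_log (by positivity)]; field_simp
  obtain ⟨ρ₀, hρ₀, η₁, hη₁, hgr⟩ := I.exists_small_growth hp hΓ hΓb hL hτ
  have happ : ∀ ε > 0, ∃ G : X →L[ℂ] X, IsFiniteRank G ∧ ‖L - G‖ < ε := by
    intro ε hε
    obtain ⟨G, hG, h⟩ := I.dense_finiteRank L hL ε hε
    exact ⟨G, hG, (I.opNorm_le _ (I.sub_mem hL (I.finiteRank_mem G hG))).trans_lt h⟩
  obtain ⟨r, hr, hrδ, P, hP, hPP, hLP, ⟨k, hk⟩, hlarge, hsum⟩ :=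
    exists_splitting (L := L) p hp happ (inv_pos.mpr (by linarith : (0 : ℝ) < ρ₀))
  have hρ : ρ₀ ≤ r⁻¹ := (le_inv_comm₀ hr (by linarith)).mp hrδ.le
  obtain ⟨M, hM, hMτ, hgrM⟩ := hgr r⁻¹ hρ
  have hPLbound : ‖detp p (P * L)‖ ≤ B := by
    refine (hΓb _ (hP.mul_right L)).trans (Real.exp_le_exp.mpr ?_)
    gcongr
    exact ENNReal.toReal_le_of_le_ofReal (by positivity) (hsum.trans (I.eig_le L hL))
  set Q := 1 - P with hQ
  have hQQ : Q * Q = Q := by rw [hQ, sub_mul, one_mul, mul_sub, mul_one, hPP, sub_self, sub_zero]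
  have hQP : Q * P = 0 := by rw [hQ, sub_mul, one_mul, hPP, sub_self]
  have hPQ : P * Q = 0 := by rw [hQ, mul_sub, mul_one, hPP, sub_self]
  have hLQ : Commute L Q := (Commute.one_right L).sub_right hLP
  obtain ⟨η₂, hη₂, hcont⟩ : ∃ η₂, 0 < η₂ ∧ ∀ T : X →L[ℂ] X, ‖T - Q * L‖ < η₂ →
      ‖T ^ k‖ < r ^ k := by
    have hc : ContinuousAt (fun T : X →L[ℂ] X => ‖T ^ k‖) (Q * L) := by fun_prop
    obtain ⟨η₂, hη₂, h⟩ := Metric.mem_nhds_iff.mp (hc.eventually (gt_mem_nhds hk))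
    exact ⟨η₂, hη₂, fun T hT => h (by rwa [Metric.mem_ball, dist_eq_norm])⟩
  obtain ⟨D, hD0, hD⟩ := I.exists_norm_detp_sub_le hp hΓ hΓb (I.q * (1 + I.norm' L))
  set c := ‖Q‖ * ‖Q‖
  have hc0 : 0 ≤ c := by positivity
  set κ := min (min η₁ η₂) 1
  have hκ : 0 < κ := lt_min (lt_min hη₁ hη₂) one_pos
  set η := min (κ / (c + 1)) (min 1 (ε / (2 * (D + 1))) / (2 * (I.q * (1 + c))))
  refine ⟨η, lt_min (by positivity) (by positivity), fun F hF hFL => ?_⟩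
  have hFm := I.finiteRank_mem F hF
  have hFLm := I.sub_mem hFm hL
  have hFL0 := I.norm'_nonneg _ hFLm
  set F' := Q * F * Q
  have hF' : IsFiniteRank F' := (hF.mul_left Q).mul_right Q
  set Ft := P * L + F'
  have hFt : IsFiniteRank Ft := (hP.mul_right L).add hF'
  have hFtm := I.finiteRank_mem Ft hFt
  have eQ : Q * L = Q * L * Q := by rw [← hLQ.eq, mul_assoc, hQQ]
  have e1 : F' - Q * L = Q * (F - L) * Q := by
    rw [mul_sub Q F L, sub_mul (Q * F), ← eQ]
  have e2 : Ft - L = Q * (F - L) * Q := by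
    rw [← e1]
    have : L = P * L + Q * L := by rw [hQ, sub_mul, one_mul]; abel
    calc Ft - L = Ft - (P * L + Q * L) := by rw [← this]
      _ = F' - Q * L := by simp only [Ft]; abel
  have hFtL : I.norm' (Ft - L) ≤ c * I.norm' (F - L) := by
    rw [e2]; exact (I.mul_norm'_le _ hFLm Q Q).trans_eq (by ring)
  have hlt : I.norm' (Ft - L) < κ := by
    refine hFtL.trans_lt ?_
    have : I.norm' (F - L) < κ / (c + 1) := hFL.trans_le (min_le_left _ _)
    rw [lt_div_iff₀ (by positivity)] at this
    nlinarith
  have hlt' : ‖F' - Q * L‖ < η₂ := by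
    rw [e1, ← e2]
    exact (I.opNorm_le _ (I.sub_mem hFtm hL)).trans_lt
      (hlt.trans_le ((min_le_left _ _).trans (min_le_right _ _)))
  have hFtb : ‖detp p Ft‖ ≤ B + ε / 2 := by
    refine (norm_detp_le_of_splitting (L := L) hP hPP hLP hF' ?_ ?_ (hρ₀.trans hρ) hM ?_
      (k := k) ?_ ?_).trans ?_
    · simp only [F']; rw [← mul_assoc, ← mul_assoc, hPQ, zero_mul, zero_mul]
    · simp only [F']; rw [mul_assoc, hQP, mul_zero]
    · rwa [inv_inv]
    · rw [inv_inv]; exact hcont _ hlt'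
    · exact hgrM Ft hFt (hlt.trans_le ((min_le_left _ _).trans (min_le_left _ _)))
    · rw [← hBτ]
      gcongr
  have hFtn : I.norm' Ft ≤ I.q * (1 + I.norm' L) := by
    have : Ft = (Ft - L) + L := by abel
    rw [this]
    refine (I.norm'_add_le _ (I.sub_mem hFtm hL) _ hL).trans ?_
    gcongr
    exact hlt.le.trans (min_le_right _ _)
  have hdiff : I.norm' (F - Ft) ≤ I.q * (1 + c) * I.norm' (F - L) := by
    have : F - Ft = (F - L) - (Ft - L) := by abel
    rw [this]
    refine (I.norm'_sub_le hFLm (I.sub_mem hFtm hL)).trans ?_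
    rw [mul_assoc, add_mul, one_mul]
    gcongr
  have hdiff' : I.norm' (F - Ft) < min 1 (ε / (2 * (D + 1))) := by
    refine hdiff.trans_lt ?_
    have h0 : 0 < min 1 (ε / (2 * (D + 1))) := by positivity
    have : I.norm' (F - L) < min 1 (ε / (2 * (D + 1))) / (2 * (I.q * (1 + c))) :=
      hFL.trans_le (min_le_right _ _)
    rw [lt_div_iff₀ (by positivity)] at this
    nlinarith [mul_nonneg hFL0 (by positivity : 0 ≤ I.q * (1 + c))]
  have hDF := hD Ft F hFt hF hFtn (hdiff'.trans_le (min_le_left _ _))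
  have hDε : D * I.norm' (F - Ft) ≤ ε / 2 := by
    have h1 : I.norm' (F - Ft) ≤ ε / (2 * (D + 1)) := hdiff'.le.trans (min_le_right _ _)
    calc D * I.norm' (F - Ft) ≤ D * (ε / (2 * (D + 1))) := by gcongr
      _ = ε / 2 * (D / (D + 1)) := by field_simp
      _ ≤ ε / 2 := mul_le_of_le_one_right (by positivity)
          ((div_le_one (by positivity)).mpr (by linarith))
  calc ‖detp p F‖ = ‖(detp p F - detp p Ft) + detp p Ft‖ := by rw [sub_add_cancel]
    _ ≤ ‖detp p F - detp p Ft‖ + ‖detp p Ft‖ := norm_add_le _ _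
    _ ≤ B + ε := by linarith

end ApproximateBound

section EigenvalueCount

variable {p : ℝ} (I : LpIdeal p X) {A K : X →L[ℂ] X}

theorem norm_inverse_one_sub_smul_le {w : ℂ} (h : ‖w‖ * ‖A‖ < 1) :
    ‖Ring.inverse (1 - w • A)‖ ≤ (1 - ‖w‖ * ‖A‖)⁻¹ := by
  have h' : ‖w • A‖ < 1 := by rwa [norm_smul]
  rw [NormedRing.inverse_one_sub _ h']
  have := tsum_geometric_le_of_norm_lt_one (w • A) h'
  rw [norm_smul] at this
  have h1 : ‖(1 : X →L[ℂ] X)‖ ≤ 1 := ContinuousLinearMap.norm_id_le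
  exact this.trans (by linarith)

theorem LpIdeal.mul_left_mem (B : X →L[ℂ] X) (hK : K ∈ I.carrier) : B * K ∈ I.carrier := by
  simpa using I.mul_mem K hK B 1

theorem LpIdeal.norm'_mul_left_le (B : X →L[ℂ] X) (hK : K ∈ I.carrier) :
    I.norm' (B * K) ≤ ‖B‖ * I.norm' K := by
  have h := I.mul_norm'_le K hK B 1
  rw [mul_one] at h
  have h1 : ‖(1 : X →L[ℂ] X)‖ ≤ 1 := ContinuousLinearMap.norm_id_le
  have h0 := I.norm'_nonneg K hK
  exact h.trans (mul_le_of_le_one_right (by positivity) h1)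

theorem LpIdeal.norm'_mul_right_le (B : X →L[ℂ] X) (hK : K ∈ I.carrier) :
    I.norm' (K * B) ≤ I.norm' K * ‖B‖ := by
  have h := I.mul_norm'_le K hK 1 B
  rw [one_mul] at h
  have h1 : ‖(1 : X →L[ℂ] X)‖ ≤ 1 := ContinuousLinearMap.norm_id_le
  have h0 := I.norm'_nonneg K hK
  refine h.trans ?_
  rw [mul_assoc]
  exact mul_le_of_le_one_left (by positivity) h1

variable (hp : 0 < p) {Γ : ℝ} (hΓ : 0 < Γ)
  (hΓb : ∀ F : X →L[ℂ] X, IsFiniteRank F → ‖detp p F‖ ≤ Real.exp (Γ * (eigSum p F).toReal))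

include hp hΓ hΓb

theorem LpIdeal.exists_norm_detp_inverse_mul_le (hK : K ∈ I.carrier) {R : ℝ} (hR : 0 < R)
    (hRA : R * ‖A‖ < 1) {ε : ℝ} (hε : 0 < ε) :
    ∃ η, 0 < η ∧ ∀ F : X →L[ℂ] X, IsFiniteRank F → I.norm' (F - K) < η → ∀ w : ℂ, ‖w‖ = R →
      ‖detp p (w • (Ring.inverse (1 - w • A) * F))‖ ≤
        Real.exp (Γ * (I.γ * (R * (1 - R * ‖A‖)⁻¹ * I.norm' K)) ^ p) + ε := by
  have hq := I.one_le_q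
  have hγ := I.γ_nonneg
  have hn := I.norm'_nonneg K hK
  set b := R * (1 - R * ‖A‖)⁻¹
  have hb : 0 < b := mul_pos hR (inv_pos.mpr (by linarith))
  set W : ℂ → X →L[ℂ] X := fun w => w • Ring.inverse (1 - w • A)
  have hW : ∀ w, ‖w‖ = R → ‖W w‖ ≤ b := by
    intro w hw
    simp only [W, b]
    rw [norm_smul, hw]
    have := norm_inverse_one_sub_smul_le (A := A) (w := w) (by rwa [hw])
    rw [hw] at this
    gcongr
  have key : ∃ η, 0 < η ∧ ∀ F : X →L[ℂ] X, IsFiniteRank F → I.norm' (F - K) < η →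
      ∀ w ∈ Metric.sphere (0 : ℂ) R, ‖w‖ = R → ‖detp p (W w * F)‖ ≤
        Real.exp (Γ * (I.γ * (b * I.norm' K)) ^ p) + ε := by
    refine IsCompact.induction_on (isCompact_sphere (0 : ℂ) R)
      (p := fun s => ∃ η, 0 < η ∧ ∀ F : X →L[ℂ] X, IsFiniteRank F → I.norm' (F - K) < η →
        ∀ w ∈ s, ‖w‖ = R → ‖detp p (W w * F)‖ ≤
          Real.exp (Γ * (I.γ * (b * I.norm' K)) ^ p) + ε)
      ⟨1, one_pos, fun _ _ _ w hw => absurd hw (Set.notMem_empty w)⟩ ?_ ?_ ?_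
    · rintro s t hst ⟨η, hη, h⟩
      exact ⟨η, hη, fun F hF hFK w hw => h F hF hFK w (hst hw)⟩
    · rintro s t ⟨η, hη, h⟩ ⟨η', hη', h'⟩
      refine ⟨min η η', lt_min hη hη', fun F hF hFK w hw => hw.elim ?_ ?_⟩
      · exact h F hF (hFK.trans_le (min_le_left _ _)) w
      · exact h' F hF (hFK.trans_le (min_le_right _ _)) w
    · intro w₀ hw₀
      have hw₀R : ‖w₀‖ = R := by simpa using hw₀
      have hL := I.mul_left_mem (W w₀) hK
      have hLn : I.norm' (W w₀ * K) ≤ b * I.norm' K :=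
        (I.norm'_mul_left_le _ hK).trans (mul_le_mul_of_nonneg_right (hW w₀ hw₀R) hn)
      obtain ⟨η, hη, h⟩ := I.exists_norm_detp_le_add hp hΓ hΓb hL hε
      have hc : ContinuousAt W w₀ :=
        continuousAt_id.smul (differentiableAt_inverse_one_sub_smul
          (isUnit_one_sub_smul (by rwa [hw₀R]))).continuousAt
      have hδ : 0 < η / (2 * I.q * (I.norm' K + 1)) := by positivity
      refine ⟨{w | ‖W w - W w₀‖ < η / (2 * I.q * (I.norm' K + 1))},
        mem_nhdsWithin_of_mem_nhds ?_, η / (2 * I.q * b), by positivity,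
        fun F hF hFK w hw hwR => ?_⟩
      · have := hc.eventually (Metric.ball_mem_nhds _ hδ)
        filter_upwards [this] with w hw
        rwa [dist_eq_norm] at hw
      · have hFm := I.finiteRank_mem F hF
        have hFKm := I.sub_mem hFm hK
        have hN0 := I.norm'_nonneg _ hFKm
        have e : W w * F - W w₀ * K = W w * (F - K) + (W w - W w₀) * K := by
          rw [mul_sub (W w) F K, sub_mul (W w) (W w₀) K]; abel
        have hw' : ‖W w - W w₀‖ < η / (2 * I.q * (I.norm' K + 1)) := hw
        have h1 : ‖W w‖ * I.norm' (F - K) < η / (2 * I.q) := by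
          calc ‖W w‖ * I.norm' (F - K) ≤ b * I.norm' (F - K) := by gcongr; exact hW w hwR
            _ < b * (η / (2 * I.q * b)) := by gcongr
            _ = η / (2 * I.q) := by field_simp
        have h2 : ‖W w - W w₀‖ * I.norm' K ≤ η / (2 * I.q) := by
          calc ‖W w - W w₀‖ * I.norm' K ≤ η / (2 * I.q * (I.norm' K + 1)) * (I.norm' K + 1) := by
                gcongr; linarith
            _ = η / (2 * I.q) := by field_simp
        have h3 : I.norm' (W w * F - W w₀ * K) < η := by
          rw [e]
          calc _ ≤ I.q * (I.norm' (W w * (F - K)) + I.norm' ((W w - W w₀) * K)) :=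
                I.norm'_add_le _ (I.mul_left_mem _ hFKm) _ (I.mul_left_mem _ hK)
            _ ≤ I.q * (‖W w‖ * I.norm' (F - K) + ‖W w - W w₀‖ * I.norm' K) := by
                gcongr
                · exact I.norm'_mul_left_le _ hFKm
                · exact I.norm'_mul_left_le _ hK
            _ < I.q * (η / (2 * I.q) + η / (2 * I.q)) := by
                refine mul_lt_mul_of_pos_left ?_ (by linarith)
                exact add_lt_add_of_lt_of_le h1 h2
            _ = η := by field_simp; ring
        refine (h _ (hF.mul_left _) h3).trans ?_
        have := I.norm'_nonneg _ hL
        gcongr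
  obtain ⟨η, hη, h⟩ := key
  refine ⟨η, hη, fun F hF hFK w hw => ?_⟩
  rw [← smul_mul_assoc]
  exact h F hF hFK w (by simpa using hw) hw

/-- Jensen's estimate for finitely many discrete eigenvalues outside a disk. -/
theorem LpIdeal.pow_sum_algebraicMultiplicity_le (hK : K ∈ I.carrier) {r s : ℝ} (hr : ‖A‖ < r)
    (hrs : r < s) (S : Finset ℂ)
    (hS : ∀ μ ∈ S, s < ‖μ‖ ∧ IsDiscreteEigenvalue (A + K) μ) :
    (s / r) ^ (∑ μ ∈ S, algebraicMultiplicity (A + K) μ) ≤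
      Real.exp (Γ * (I.γ * ((r - ‖A‖)⁻¹ * I.norm' K)) ^ p) := by
  have hr0 : 0 < r := (norm_nonneg A).trans_lt hr
  have hR : 0 < r⁻¹ := inv_pos.mpr hr0
  have hRA : r⁻¹ * ‖A‖ < 1 := by
    rw [inv_mul_lt_iff₀ hr0, mul_one]; exact hr
  have hb : r⁻¹ * (1 - r⁻¹ * ‖A‖)⁻¹ = (r - ‖A‖)⁻¹ := by
    rw [← mul_inv, mul_sub, mul_one, mul_inv_cancel_left₀ hr0.ne']
  refine le_of_forall_pos_le_add fun ε hε => ?_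
  obtain ⟨η, hη, h⟩ := I.exists_norm_detp_inverse_mul_le (A := A) hp hΓ hΓb hK hR hRA hε
  rw [hb] at h
  obtain ⟨V, hfin, hV, hle, hcard⟩ := exists_invariant_le_iSup (A + K) S fun μ hμ => (hS μ hμ).2
  obtain ⟨Q, hQ⟩ := Submodule.ClosedComplemented.of_finiteDimensional V
  set E : X →L[ℂ] X := V.subtypeL.comp Q with hE
  have hEV : ∀ v ∈ V, E v = v := fun v hv => congrArg Subtype.val (hQ ⟨v, hv⟩)
  have hEfin : IsFiniteRank E := isFiniteRank_of_forall_mem V fun x => (Q x).2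
  obtain ⟨F₀, hF₀, hF₀K⟩ := I.dense_finiteRank K hK (η / (‖1 - E‖ + 1)) (by positivity)
  have hm := I.sub_mem hK (I.finiteRank_mem F₀ hF₀)
  have hN0 := I.norm'_nonneg _ hm
  set F := F₀ + (K - F₀) * E
  have hF : IsFiniteRank F := hF₀.add (hEfin.mul_left _)
  have hFK : I.norm' (F - K) < η := by
    rw [I.norm'_sub_comm (I.finiteRank_mem F hF) hK]
    have e : K - F = (K - F₀) * (1 - E) := by
      rw [mul_sub (K - F₀), mul_one]; simp only [F]; abel
    rw [e]
    refine (I.norm'_mul_right_le _ hm).trans_lt ?_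
    rw [lt_div_iff₀ (by positivity)] at hF₀K
    nlinarith
  have hTV : ∀ v ∈ V, (A + F) v = (A + K) v := by
    intro v hv
    simp [F, hEV v hv]
  have hFV : ∀ v ∈ V, (A + F) v ∈ V := fun v hv => by rw [hTV v hv]; exact hV v hv
  obtain ⟨k, hk0, hk, hdet⟩ := exists_detp_eq_det_mul p A F hF V hFV
  have hV' : ∀ v ∈ V, ((A + K : X →L[ℂ] X) : X →ₗ[ℂ] X) v ∈ V := hV
  have hrestr : ((A + F : X →L[ℂ] X) : X →ₗ[ℂ] X).restrict hFV =
      ((A + K : X →L[ℂ] X) : X →ₗ[ℂ] X).restrict hV' := by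
    ext v; exact hTV v v.2
  rw [hrestr] at hdet
  set B : Module.End ℂ V := ((A + K : X →L[ℂ] X) : X →ₗ[ℂ] X).restrict hV'
  have hunit : ∀ w : ℂ, ‖w‖ ≤ r⁻¹ → IsUnit (1 - w • A) := fun w hw =>
    isUnit_one_sub_smul ((mul_le_mul_of_nonneg_right hw (norm_nonneg A)).trans_lt hRA)
  have hs : ∀ a ∈ B.charpoly.roots, s / r ≤ ‖a‖ * r⁻¹ := by
    intro a ha
    have := (hS a (mem_of_hasEigenvalue_restrict hV' hle (hasEigenvalue_of_mem_roots ha))).1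
    rw [div_eq_mul_inv]
    gcongr
  have hsr : 1 ≤ s / r := (one_le_div hr0).mpr hrs.le
  refine (pow_le_pow_right₀ hsr (hcard.trans_eq (card_roots_charpoly B).symm)).trans ?_
  refine pow_card_le_of_norm_prod_le hR (by linarith) _ hs hk0
    (fun z hz => hk z (hunit z (by simpa using hz))) fun z hz => ?_
  rw [← det_one_sub_smul_eq_prod_roots, ← hdet z (hunit z hz.le)]
  exact h F hF hFK z hz

theorem LpIdeal.sum_algebraicMultiplicity_le (hK : K ∈ I.carrier) {s : ℝ} (hs : ‖A‖ < s)
    (S : Finset ℂ) (hS : ∀ μ ∈ S, s < ‖μ‖ ∧ IsDiscreteEigenvalue (A + K) μ) :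
    ((∑ μ ∈ S, algebraicMultiplicity (A + K) μ : ℕ) : ℝ) ≤
      I.γ ^ p * Γ * ((p + 1) ^ (p + 1) / p ^ p) * (s / (s - ‖A‖) ^ (p + 1)) * I.norm' K ^ p := by
  have hγ := I.γ_nonneg
  have hn := I.norm'_nonneg K hK
  have hs0 : 0 < s := (norm_nonneg A).trans_lt hs
  set δ := s - ‖A‖ with hδ
  have hδ0 : 0 < δ := by linarith
  set r := ‖A‖ + p / (p + 1) * δ with hrdef
  have hrA : r - ‖A‖ = p * δ / (p + 1) := by rw [hrdef]; ring
  have hsr : s - r = δ / (p + 1) := by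
    rw [hrdef]; field_simp; rw [hδ]; ring
  have hr : ‖A‖ < r := by
    have : 0 < r - ‖A‖ := by rw [hrA]; positivity
    linarith
  have hrs : r < s := by
    have : 0 < s - r := by rw [hsr]; positivity
    linarith
  have hr0 : 0 < r := (norm_nonneg A).trans_lt hr
  set n := ∑ μ ∈ S, algebraicMultiplicity (A + K) μ
  have h := I.pow_sum_algebraicMultiplicity_le hp hΓ hΓb hK hr hrs S hS
  have h1 : (n : ℝ) * Real.log (s / r) ≤ Γ * (I.γ * ((r - ‖A‖)⁻¹ * I.norm' K)) ^ p := by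
    rw [← Real.log_pow]
    exact (Real.log_le_iff_le_exp (by positivity)).mpr h
  have h2 : δ / (p + 1) / s ≤ Real.log (s / r) := by
    have := Real.one_sub_inv_le_log_of_pos (div_pos hs0 hr0)
    rw [inv_div] at this
    rw [← hsr, sub_div, div_self hs0.ne']
    exact this
  have h3 : (n : ℝ) * (δ / (p + 1) / s) ≤ Γ * (I.γ * ((r - ‖A‖)⁻¹ * I.norm' K)) ^ p :=
    (mul_le_mul_of_nonneg_left h2 (Nat.cast_nonneg n)).trans h1
  rw [← le_div_iff₀ (by positivity)] at h3
  refine h3.trans_eq ?_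
  rw [hrA, Real.mul_rpow hγ (by positivity), Real.mul_rpow (by positivity) hn,
    Real.inv_rpow (by positivity), Real.div_rpow (by positivity) (by positivity),
    Real.mul_rpow hp.le hδ0.le, Real.rpow_add_one hδ0.ne', Real.rpow_add_one (by positivity)]
  have := Real.rpow_pos_of_pos hp p
  have := Real.rpow_pos_of_pos hδ0 p
  have := Real.rpow_pos_of_pos (by linarith : 0 < p + 1) p
  field_simp

end EigenvalueCount

/-- Let `I` be an `l_p`-ideal in `B(X)` with eigenvalue constant `γ`, let
`Γ > 0` satisfy the determinant bound for finite rank operators, and let `A ∈ B(X)`,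
`K ∈ I`.  Then for every `s > ‖A‖` the number of discrete eigenvalues of `A+K` in
`{z : |z| > s}`, counted with algebraic multiplicity, is at most
`γ^p Γ ((p+1)^{p+1}/p^p) · s/(s-‖A‖)^{p+1} · ‖K‖_I^p`. -/
theorem eigCount_outside_opNorm_ball_le (p : ℝ) (hp : 0 < p) (I : LpIdeal p X)
    (Γ : ℝ) (hΓ : 0 < Γ)
    (hΓb : ∀ F : X →L[ℂ] X, IsFiniteRank F →
      ‖detp p F‖ ≤ Real.exp (Γ * (eigSum p F).toReal))
    (A K : X →L[ℂ] X) (hK : K ∈ I.carrier) :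
    ∀ s : ℝ, ‖A‖ < s →
      eigCount (A + K) {z : ℂ | s < ‖z‖} ≤
        ENNReal.ofReal (I.γ ^ p * Γ * ((p + 1) ^ (p + 1) / p ^ p) *
          (s / (s - ‖A‖) ^ (p + 1)) * I.norm' K ^ p) := by
  intro s hs
  rw [eigCount, ENNReal.tsum_eq_iSup_sum]
  refine iSup_le fun t => ?_
  have h := I.sum_algebraicMultiplicity_le hp hΓ hΓb hK hs (t.map (Function.Embedding.subtype _))
    (fun μ hμ => by
      obtain ⟨ν, -, rfl⟩ := Finset.mem_map.mp hμ
      exact ν.2)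
  rw [Finset.sum_map] at h
  rw [← Nat.cast_sum, ← ENNReal.ofReal_natCast]
  exact ENNReal.ofReal_le_ofReal h
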